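/- arXiv:2007.15827 — 6 statements merged into one kernel-verified Lean document; each statement's English description precedes it below -/
import Mathlib

section
/- Let J ≥ 5 and let F : (ℤ/Jℤ → ℝ) → (ℤ/Jℤ → ℝ) be the Lorenz-96 nonlinearity F(u)_ℓ = (u_{ℓ+1} − u_{ℓ-2})·u_{ℓ-1}, with indices taken in ℤ/Jℤ. For m ∈ ℤ/Jℤ let δ_m denote the standard basis vector (the function equal to 1 at m and 0 elsewhere), regarded as a constant vector field. Then for every i ∈ ℤ/Jℤ, the iterated Lie bracket of vector fields satisfies [δ_{i+1}, [δ_i, F]] = −δ_{i+2}; that is, the Lie bracket of the constant field δ_{i+1} with the Lie bracket of the constant field δ_i with F is the constant vector field −δ_{i+2}. -/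
/-- The Lorenz-96 nonlinearity `F(u)_ℓ = (u_{ℓ+1} − u_{ℓ-2}) u_{ℓ-1}` with cyclic
indices in `ℤ/Jℤ`. -/
noncomputable def lorenzF (J : ℕ) (u : ZMod J → ℝ) : ZMod J → ℝ :=
  fun ℓ => (u (ℓ + 1) - u (ℓ - 2)) * u (ℓ - 1)

/-- The polarization of the quadratic map `lorenzF`. -/
noncomputable def lorenzBilin (J : ℕ) (a b : ZMod J → ℝ) : ZMod J → ℝ :=
  fun ℓ => (a (ℓ + 1) - a (ℓ - 2)) * b (ℓ - 1) + (b (ℓ + 1) - b (ℓ - 2)) * a (ℓ - 1)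

theorem lieBracket_const_left_eq_fderiv {E : Type*} [NormedAddCommGroup E] [NormedSpace ℝ E]
    (v : E) (W : E → E) :
    VectorField.lieBracket ℝ (fun _ => v) W = fun x => fderiv ℝ W x v := by
  ext1 x
  simp [VectorField.lieBracket]

theorem fderiv_lorenzF_apply (J : ℕ) [NeZero J] (u v : ZMod J → ℝ) :
    fderiv ℝ (lorenzF J) u v = lorenzBilin J v u := by
  have coord (m : ZMod J) := hasFDerivAt_apply (𝕜 := ℝ) m u
  have h := hasFDerivAt_pi.2 fun ℓ : ZMod J =>
    ((coord (ℓ + 1)).sub (coord (ℓ - 2))).mul (coord (ℓ - 1))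
  have h' : HasFDerivAt (lorenzF J) _ u := h
  rw [h'.fderiv]
  ext ℓ
  simp [lorenzBilin]
  ring

theorem fderiv_lorenzBilin_apply (J : ℕ) [NeZero J] (a u v : ZMod J → ℝ) :
    fderiv ℝ (lorenzBilin J a) u v = lorenzBilin J a v := by
  have coord (m : ZMod J) := hasFDerivAt_apply (𝕜 := ℝ) m u
  have h := hasFDerivAt_pi.2 fun ℓ : ZMod J =>
    ((coord (ℓ - 1)).const_mul (a (ℓ + 1) - a (ℓ - 2))).add
      (((coord (ℓ + 1)).sub (coord (ℓ - 2))).mul_const (a (ℓ - 1)))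
  have h' : HasFDerivAt (lorenzBilin J a) _ u := h
  rw [h'.fderiv]
  ext ℓ
  simp [lorenzBilin]
  ring

theorem ZMod.natCast_ne_zero_of_lt {J n : ℕ} (hn : 0 < n) (hJ : n < J) : (n : ZMod J) ≠ 0 := by
  rw [Ne, ZMod.natCast_eq_zero_iff]
  exact Nat.not_dvd_of_pos_of_lt hn hJ

theorem lorenzBilin_single_single_add_one {J : ℕ} (hJ : 4 ≤ J) (i : ZMod J) :
    lorenzBilin J (Pi.single i 1) (Pi.single (i + 1) 1) = -Pi.single (i + 2) 1 := by
  have h1 : (1 : ZMod J) ≠ 0 := by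
    simpa using ZMod.natCast_ne_zero_of_lt (n := 1) (J := J) (by lia) (by lia)
  have h2 : (2 : ZMod J) ≠ 0 := by
    simpa using ZMod.natCast_ne_zero_of_lt (n := 2) (J := J) (by lia) (by lia)
  have h3 : (3 : ZMod J) ≠ 0 := by
    simpa using ZMod.natCast_ne_zero_of_lt (n := 3) (J := J) (by lia) (by lia)
  ext ℓ
  simp only [lorenzBilin, Pi.single_apply, Pi.neg_apply]
  grind

/-- For `J ≥ 5` and every `i ∈ ℤ/Jℤ`, the iterated Lie bracket of vector fields on
`ℝ^{ℤ/Jℤ}` satisfies `[δ_{i+1}, [δ_i, F]] = −δ_{i+2}`, where `δ_m` is the standard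
basis vector at `m` regarded as a constant vector field and `F` is the Lorenz-96
nonlinearity. -/
theorem lieBracket_lorenzF (J : ℕ) [NeZero J] (hJ : 5 ≤ J) (i : ZMod J) :
    VectorField.lieBracket ℝ (fun _ => Pi.single (i + 1) (1 : ℝ))
        (VectorField.lieBracket ℝ (fun _ => Pi.single i (1 : ℝ)) (lorenzF J)) =
      fun _ => -Pi.single (i + 2) (1 : ℝ) := by
  have h : VectorField.lieBracket ℝ (fun _ => Pi.single i (1 : ℝ)) (lorenzF J) =
      lorenzBilin J (Pi.single i 1) := by
    rw [lieBracket_const_left_eq_fderiv]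
    exact funext fun u => fderiv_lorenzF_apply J u _
  rw [h, lieBracket_const_left_eq_fderiv]
  ext1 u
  rw [fderiv_lorenzBilin_apply, lorenzBilin_single_single_add_one (by lia)]
end

section
/- Let n ≥ 1 and let E be n-dimensional Euclidean space. For a continuous linear map A : E → E define the vector field V_A : E → E by V_A(v) := A v − ⟨v, A v⟩ v. Then for all continuous linear maps A, B on E and every v ∈ E with ‖v‖ = 1, the Lie bracket of vector fields satisfies [V_A, V_B](v) = −V_{[A,B]}(v), where [A,B] = A∘B − B∘A is the commutator of linear maps. -/
open scoped RealInnerProductSpace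

/-- The projective vector field `V_A(v) = A v − ⟨v, A v⟩ v` on Euclidean space induced by
a continuous linear map `A`. -/
noncomputable def projVF {n : ℕ} (A : EuclideanSpace ℝ (Fin n) →L[ℝ] EuclideanSpace ℝ (Fin n))
    (v : EuclideanSpace ℝ (Fin n)) : EuclideanSpace ℝ (Fin n) :=
  A v - ⟪v, A v⟫ • v

lemma hasFDerivAt_projVF {n : ℕ}
    (A : EuclideanSpace ℝ (Fin n) →L[ℝ] EuclideanSpace ℝ (Fin n))
    (v : EuclideanSpace ℝ (Fin n)) :
    HasFDerivAt (projVF A)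
      (A - (⟪v, A v⟫ • ContinuousLinearMap.id ℝ (EuclideanSpace ℝ (Fin n)) +
        (((fderivInnerCLM ℝ (v, A v)).comp
          ((ContinuousLinearMap.id ℝ (EuclideanSpace ℝ (Fin n))).prod A)).smulRight v))) v :=
  A.hasFDerivAt.sub (((hasFDerivAt_id v).inner ℝ A.hasFDerivAt).smul (hasFDerivAt_id v))

lemma fderiv_projVF_apply {n : ℕ}
    (A : EuclideanSpace ℝ (Fin n) →L[ℝ] EuclideanSpace ℝ (Fin n))
    (v w : EuclideanSpace ℝ (Fin n)) :
    fderiv ℝ (projVF A) v w = A w - (⟪v, A v⟫ • w + (⟪v, A w⟫ + ⟪w, A v⟫) • v) := by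
  simp [(hasFDerivAt_projVF A v).fderiv, fderivInnerCLM_apply]

/-- For continuous linear maps `A, B` on `n`-dimensional Euclidean space and every unit
vector `v`, the Lie bracket of the projective vector fields satisfies
`[V_A, V_B](v) = −V_{[A,B]}(v)`, where `[A,B] = A∘B − B∘A`. -/
theorem lieBracket_projVF {n : ℕ} (hn : 1 ≤ n)
    (A B : EuclideanSpace ℝ (Fin n) →L[ℝ] EuclideanSpace ℝ (Fin n))
    (v : EuclideanSpace ℝ (Fin n)) (hv : ‖v‖ = 1) :
    VectorField.lieBracket ℝ (projVF A) (projVF B) v =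
      -projVF (A ∘L B - B ∘L A) v := by
  simp only [VectorField.lieBracket, fderiv_projVF_apply, projVF, map_sub, map_smul,
    inner_sub_right, sub_apply, ContinuousLinearMap.comp_apply]
  rw [real_inner_comm (A v) (B v)]
  module
end

section
/- Let n ≥ 1 and let E be n-dimensional Euclidean space. For a twice continuously differentiable vector field X : E → E define its lift X̃ : E × E → E × E by X̃(x,v) := (X(x), DX(x)·v − ⟨v, DX(x)·v⟩ v), where DX(x) is the Fréchet derivative of X at x. Then for all C² vector fields X, Y on E and every point (x,v) ∈ E × E with ‖v‖ = 1, the Lie bracket of the lifts equals the lift of the Lie bracket: [X̃, Ỹ](x,v) = (Z(x), DZ(x)·v − ⟨v, DZ(x)·v⟩ v), where Z := [X,Y] is the Lie bracket of X and Y on E. -/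
open scoped RealInnerProductSpace

/-- The lift of a vector field `X` on `ℝⁿ` to the sphere bundle `ℝⁿ × S^{n−1} ⊂ ℝⁿ × ℝⁿ`:
`X̃(x,v) = (X(x), DX(x)·v − ⟨v, DX(x)·v⟩ v)`. -/
noncomputable def liftVF {n : ℕ} (X : EuclideanSpace ℝ (Fin n) → EuclideanSpace ℝ (Fin n))
    (p : EuclideanSpace ℝ (Fin n) × EuclideanSpace ℝ (Fin n)) :
    EuclideanSpace ℝ (Fin n) × EuclideanSpace ℝ (Fin n) :=
  (X p.1, fderiv ℝ X p.1 p.2 - ⟪p.2, fderiv ℝ X p.1 p.2⟫ • p.2)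

/-- The derivative of the lift of a `C²` vector field. -/
theorem fderiv_liftVF_apply {n : ℕ} {X : EuclideanSpace ℝ (Fin n) → EuclideanSpace ℝ (Fin n)}
    (hX : ContDiff ℝ 2 X) (x v a b : EuclideanSpace ℝ (Fin n)) :
    fderiv ℝ (liftVF X) (x, v) (a, b) =
      (fderiv ℝ X x a,
        fderiv ℝ (fderiv ℝ X) x a v + fderiv ℝ X x b -
          (⟪v, fderiv ℝ X x v⟫ • b +
            (⟪v, fderiv ℝ (fderiv ℝ X) x a v + fderiv ℝ X x b⟫ +
              ⟪b, fderiv ℝ X x v⟫) • v)) := by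
  have h₁ : HasFDerivAt X (fderiv ℝ X x) x :=
    (hX.differentiable (by norm_num) x).hasFDerivAt
  have h₂ : HasFDerivAt (fderiv ℝ X) (fderiv ℝ (fderiv ℝ X) x) x :=
    ((hX.fderiv_right (m := 1) (by norm_num)).differentiable (by norm_num) x).hasFDerivAt
  have hfst := hasFDerivAt_fst (𝕜 := ℝ) (p := (x, v))
  have hsnd := hasFDerivAt_snd (𝕜 := ℝ) (p := (x, v))
  have hD := (h₂.comp (x, v) hfst).clm_apply hsnd
  have h := (h₁.comp (x, v) hfst).prodMk (hD.sub ((hsnd.inner ℝ hD).smul hsnd))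
  have hlift : HasFDerivAt (liftVF X) _ (x, v) := h
  rw [hlift.fderiv]
  simp [add_comm]

/-- The derivative of the Lie bracket of two `C²` vector fields. -/
theorem fderiv_lieBracket_apply {E : Type*} [NormedAddCommGroup E] [NormedSpace ℝ E]
    {X Y : E → E} (hX : ContDiff ℝ 2 X) (hY : ContDiff ℝ 2 Y) (x v : E) :
    fderiv ℝ (VectorField.lieBracket ℝ X Y) x v =
      fderiv ℝ (fderiv ℝ Y) x (X x) v + fderiv ℝ Y x (fderiv ℝ X x v) -
        (fderiv ℝ (fderiv ℝ X) x (Y x) v + fderiv ℝ X x (fderiv ℝ Y x v)) := by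
  have h₁ {W : E → E} (hW : ContDiff ℝ 2 W) : HasFDerivAt W (fderiv ℝ W x) x :=
    (hW.differentiable (by norm_num) x).hasFDerivAt
  have h₂ {W : E → E} (hW : ContDiff ℝ 2 W) :
      HasFDerivAt (fderiv ℝ W) (fderiv ℝ (fderiv ℝ W) x) x :=
    ((hW.fderiv_right (m := 1) (by norm_num)).differentiable (by norm_num) x).hasFDerivAt
  have h : HasFDerivAt (VectorField.lieBracket ℝ X Y) _ x :=
    ((h₂ hY).clm_apply (h₁ hX)).sub ((h₂ hX).clm_apply (h₁ hY))
  rw [h.fderiv, (hX.contDiffAt.isSymmSndFDerivAt (by simp)).eq (Y x) v,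
    (hY.contDiffAt.isSymmSndFDerivAt (by simp)).eq (X x) v]
  simp [add_comm]

/-- Lifting vector fields to the sphere bundle is a Lie algebra homomorphism: for `C²`
vector fields `X, Y` on `ℝⁿ` and any point `(x,v)` with `‖v‖ = 1`, the Lie bracket of the
lifts equals the lift of the Lie bracket `Z = [X,Y]`:
`[X̃, Ỹ](x,v) = (Z(x), DZ(x)·v − ⟨v, DZ(x)·v⟩ v)`. -/
theorem lieBracket_liftVF {n : ℕ} (hn : 1 ≤ n)
    (X Y : EuclideanSpace ℝ (Fin n) → EuclideanSpace ℝ (Fin n))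
    (hX : ContDiff ℝ 2 X) (hY : ContDiff ℝ 2 Y)
    (x v : EuclideanSpace ℝ (Fin n)) (hv : ‖v‖ = 1) :
    VectorField.lieBracket ℝ (liftVF X) (liftVF Y) (x, v) =
      liftVF (VectorField.lieBracket ℝ X Y) (x, v) := by
  rw [VectorField.lieBracket]
  simp only [liftVF, fderiv_liftVF_apply hX, fderiv_liftVF_apply hY,
    fderiv_lieBracket_apply hX hY, Prod.mk_sub_mk]
  refine Prod.ext rfl ?_
  simp only [map_sub, map_smul, inner_sub_left, inner_sub_right, inner_add_right,
    real_inner_smul_left, real_inner_smul_right,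
    real_inner_comm (fderiv ℝ X x v) (fderiv ℝ Y x v)]
  module
end

section
/- Let n ≥ 2 and let B : ℝⁿ × ℝⁿ → ℝⁿ be a bilinear map with ⟨x, B(x,x)⟩ = 0 for all x ∈ ℝⁿ, and such that x ↦ B(x,x) is not identically zero. Let Φ : ℝ≥0 → ℝⁿ → ℝⁿ be a flow satisfying: Φ(0,·) = id; Φ(s+t, x) = Φ(s, Φ(t,x)) for all s,t ≥ 0 and x; for every x, t ↦ Φ(t,x) is differentiable with derivative B(Φ(t,x), Φ(t,x)); the solution of this initial value problem is unique for each initial condition; and for every t ≥ 0 the map x ↦ Φ(t,x) is continuously differentiable with Fréchet derivative D(t,x) satisfying det D(t,x) = 1 (in particular D(t,x) is invertible). Define the projective flow Φ̂(t) on ℝⁿ × S^{n-1} by Φ̂(t)(x,v) = (Φ(t,x), D(t,x)v/‖D(t,x)v‖), where S^{n-1} = {v : ‖v‖ = 1}. Let ν be a Borel probability measure on ℝⁿ × S^{n-1} that is Φ̂(t)-invariant for every t ≥ 0 and whose first marginal μ (defined by μ(K) = ν(K × S^{n-1})) is absolutely continuous with respect to Lebesgue measure on ℝⁿ. Then ν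 is mutually singular with respect to the product of Lebesgue measure on ℝⁿ and the surface measure σ on S^{n-1}. -/
open MeasureTheory
open scoped RealInnerProductSpace Classical

/-- Normalization map onto the unit sphere: sends `w ≠ 0` to `w/‖w‖` (regarded as a point
of the unit sphere); a junk default value `v` is used when `w = 0`. -/
noncomputable def sphereProj {n : ℕ} (w : EuclideanSpace ℝ (Fin n))
    (v : Metric.sphere (0 : EuclideanSpace ℝ (Fin n)) 1) :
    Metric.sphere (0 : EuclideanSpace ℝ (Fin n)) 1 :=
  if h : w = 0 then v
  else
    ⟨‖w‖⁻¹ • w, by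
      simp only [mem_sphere_zero_iff_norm, norm_smul, norm_inv, norm_norm]
      exact inv_mul_cancel₀ (norm_ne_zero_iff.mpr h)⟩

section Helpers

open Set Filter Topology
open scoped ENNReal NNReal Pointwise

lemma coe_sphereProj {n : ℕ} {w : EuclideanSpace ℝ (Fin n)} (hw : w ≠ 0)
    (v : Metric.sphere (0 : EuclideanSpace ℝ (Fin n)) 1) :
    (sphereProj w v : EuclideanSpace ℝ (Fin n)) = ‖w‖⁻¹ • w := by
  simp [sphereProj, hw]

lemma norm_normalize_sub_le {E : Type*} [NormedAddCommGroup E] [NormedSpace ℝ E] {a b : E}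
    (ha : 1 ≤ ‖a‖) (hb : 1 ≤ ‖b‖) : ‖‖a‖⁻¹ • a - ‖b‖⁻¹ • b‖ ≤ 2 * ‖a - b‖ := by
  have ha0 : 0 < ‖a‖ := by linarith
  have hb0 : 0 < ‖b‖ := by linarith
  have hinv : ‖a‖⁻¹ ≤ 1 := inv_le_one_of_one_le₀ ha
  have hab : ‖a‖⁻¹ - ‖b‖⁻¹ = ‖a‖⁻¹ * ((‖b‖ - ‖a‖) * ‖b‖⁻¹) := by
    field_simp
  have h1 : ‖a‖⁻¹ • a - ‖b‖⁻¹ • b = ‖a‖⁻¹ • (a - b) + (‖a‖⁻¹ - ‖b‖⁻¹) • b := by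
    module
  have h2 : ‖‖a‖⁻¹ • (a - b)‖ ≤ ‖a - b‖ := by
    rw [norm_smul, norm_inv, norm_norm]
    exact mul_le_of_le_one_left (norm_nonneg _) hinv
  have h3 : ‖(‖a‖⁻¹ - ‖b‖⁻¹) • b‖ ≤ ‖a - b‖ := by
    rw [norm_smul, hab, Real.norm_eq_abs, abs_mul, abs_mul, abs_of_pos (inv_pos.2 ha0),
      abs_of_pos (inv_pos.2 hb0), mul_assoc, inv_mul_cancel_right₀ hb0.ne']
    calc ‖a‖⁻¹ * |‖b‖ - ‖a‖| ≤ |‖b‖ - ‖a‖| := mul_le_of_le_one_left (abs_nonneg _) hinv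
      _ ≤ ‖a - b‖ := by rw [norm_sub_rev]; exact abs_norm_sub_norm_le b a
  rw [h1]
  linarith [norm_add_le (‖a‖⁻¹ • (a - b)) ((‖a‖⁻¹ - ‖b‖⁻¹) • b)]

section SphereChart

variable {k : ℕ}

/-- The affine chart `w ↦ (w, s)` with `s` in position `i`, before projection to the sphere. -/
noncomputable def affineChart (i : Fin (k + 1)) (s : ℝ) (w : Fin k → ℝ) :
    EuclideanSpace ℝ (Fin (k + 1)) :=
  WithLp.toLp 2 (i.insertNth s w)

/-- The central projection of the affine chart to the unit sphere. -/
noncomputable def sphereChart (i : Fin (k + 1)) (s : ℝ) (w : Fin k → ℝ) :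
    Metric.sphere (0 : EuclideanSpace ℝ (Fin (k + 1))) 1 :=
  sphereProj (affineChart i s w) ⟨EuclideanSpace.single 0 1, by simp⟩

lemma abs_le_norm_affineChart (i : Fin (k + 1)) (s : ℝ) (w : Fin k → ℝ) :
    |s| ≤ ‖affineChart i s w‖ := by
  simpa [affineChart] using PiLp.norm_apply_le (affineChart i s w) i

lemma lipschitzWith_insertNth (i : Fin (k + 1)) (s : ℝ) :
    LipschitzWith 1 (fun w : Fin k → ℝ => (i.insertNth s w : Fin (k + 1) → ℝ)) := by
  refine LipschitzWith.of_dist_le_mul fun w w' => ?_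
  rw [NNReal.coe_one, one_mul, dist_pi_le_iff dist_nonneg]
  intro j
  induction j using i.succAboveCases with
  | x => simp
  | p j => simpa using dist_le_pi_dist w w' j

/-- A Lipschitz constant of the identity from the sup norm to the Euclidean norm. -/
noncomputable def euclideanConst (k : ℕ) : ℝ≥0 :=
  (Fintype.card (Fin (k + 1)) : ℝ≥0) ^ (1 / (2 : ℝ≥0∞)).toReal

lemma euclideanConst_pos (k : ℕ) : 0 < euclideanConst k :=
  NNReal.rpow_pos (by simp)

lemma lipschitzWith_affineChart (i : Fin (k + 1)) (s : ℝ) :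
    LipschitzWith (euclideanConst k) (affineChart i s) := by
  have := (PiLp.lipschitzWith_toLp 2 (fun _ : Fin (k + 1) => ℝ)).comp
    (lipschitzWith_insertNth i s)
  rw [mul_one] at this
  exact this

lemma norm_affineChart_le (i : Fin (k + 1)) {s : ℝ} (hs : |s| = 1) {w : Fin k → ℝ}
    (hw : ∀ j, |w j| ≤ 1) : ‖affineChart i s w‖ ≤ euclideanConst k := by
  have h := (PiLp.lipschitzWith_toLp 2 (fun _ : Fin (k + 1) => ℝ)).norm_le_mul
    (WithLp.toLp_zero 2) (i.insertNth s w)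
  refine h.trans (mul_le_of_le_one_right (by positivity) ?_)
  rw [pi_norm_le_iff_of_nonneg zero_le_one]
  intro j
  induction j using i.succAboveCases with
  | x => simp [hs]
  | p j => simpa using hw j

lemma affineChart_ne_zero (i : Fin (k + 1)) {s : ℝ} (hs : |s| = 1) (w : Fin k → ℝ) :
    affineChart i s w ≠ 0 := by
  have := abs_le_norm_affineChart i s w
  rw [← norm_pos_iff]
  linarith

lemma lipschitzWith_sphereChart (i : Fin (k + 1)) {s : ℝ} (hs : |s| = 1) :
    LipschitzWith (2 * euclideanConst k) (sphereChart i s) := by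
  refine LipschitzWith.of_dist_le_mul fun w w' => ?_
  rw [Subtype.dist_eq, dist_eq_norm, sphereChart, sphereChart,
    coe_sphereProj (affineChart_ne_zero i hs w), coe_sphereProj (affineChart_ne_zero i hs w')]
  have h1 := abs_le_norm_affineChart i s w
  have h2 := abs_le_norm_affineChart i s w'
  rw [hs] at h1 h2
  have h3 := (lipschitzWith_affineChart i s).dist_le_mul w w'
  rw [dist_eq_norm] at h3
  push_cast
  linarith [norm_normalize_sub_le h1 h2]

/-- The cone over a set in the sphere, of height one. -/
def sphereCone {n : ℕ} (A : Set (Metric.sphere (0 : EuclideanSpace ℝ (Fin n)) 1)) :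
    Set (EuclideanSpace ℝ (Fin n)) :=
  Ioo (0 : ℝ) 1 • ((↑) '' A)

lemma mem_sphereCone_of_smul_sphereChart {A : Set (Metric.sphere _ 1)} {i : Fin (k + 1)} {s : ℝ}
    (hs : |s| = 1) {w : Fin k → ℝ} (hw : ∀ j, |w j| ≤ 1) (hA : sphereChart i s w ∈ A) {r : ℝ}
    (hr : 0 < r) (hr' : r < (euclideanConst k : ℝ)⁻¹) : r • affineChart i s w ∈ sphereCone A := by
  have hne := affineChart_ne_zero i hs w
  have hpos := norm_pos_iff.2 hne
  have hK : (0 : ℝ) < euclideanConst k := euclideanConst_pos k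
  refine Set.mem_smul.2 ⟨r * ‖affineChart i s w‖, ⟨by positivity, ?_⟩, _, ⟨_, hA, rfl⟩, ?_⟩
  · calc r * ‖affineChart i s w‖ ≤ r * euclideanConst k := by
          gcongr; exact norm_affineChart_le i hs hw
      _ < (euclideanConst k : ℝ)⁻¹ * euclideanConst k := by gcongr
      _ = 1 := inv_mul_cancel₀ hK.ne'
  · rw [sphereChart, coe_sphereProj hne, smul_smul, mul_assoc, mul_inv_cancel₀ hpos.ne', mul_one]

lemma volume_chart_le (i : Fin (k + 1)) {s : ℝ} (hs : |s| = 1)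
    {A : Set (Metric.sphere (0 : EuclideanSpace ℝ (Fin (k + 1))) 1)} (hA : MeasurableSet A) :
    ENNReal.ofReal ((euclideanConst k : ℝ)⁻¹ / 2) ^ (k + 1) *
      volume {w : Fin k → ℝ | (∀ j, |w j| ≤ 1) ∧ sphereChart i s w ∈ A} ≤
      volume (sphereCone A) := by
  set W : Set (Fin k → ℝ) := {w | (∀ j, |w j| ≤ 1) ∧ sphereChart i s w ∈ A}
  have hWm : MeasurableSet W := by
    refine MeasurableSet.inter ?_ ((lipschitzWith_sphereChart i hs).continuous.measurable hA)
    have : {w : Fin k → ℝ | ∀ j, |w j| ≤ 1} = ⋂ j, {w : Fin k → ℝ | |w j| ≤ 1} := by ext; simp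
    change MeasurableSet {w : Fin k → ℝ | ∀ j, |w j| ≤ 1}
    rw [this]
    exact MeasurableSet.iInter fun j => measurableSet_le (by fun_prop) measurable_const
  set c : ℝ := (euclideanConst k : ℝ)⁻¹ / 2 with hc
  have hK : (0 : ℝ) < euclideanConst k := euclideanConst_pos k
  have hc0 : 0 < c := by positivity
  have hss : s * s = 1 := by rw [← abs_mul_abs_self, hs, one_mul]
  set S : Set (ℝ × (Fin k → ℝ)) := {p | s * p.1 ∈ Ioo c (2 * c) ∧ (s * p.1)⁻¹ • p.2 ∈ W}
  have hSm : MeasurableSet S := by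
    refine MeasurableSet.inter ?_ ?_
    · exact (show Measurable fun p : ℝ × (Fin k → ℝ) => s * p.1 by fun_prop) measurableSet_Ioo
    · exact (show Measurable fun p : ℝ × (Fin k → ℝ) => (s * p.1)⁻¹ • p.2 by fun_prop) hWm
  let e : (ℝ × (Fin k → ℝ)) ≃ᵐ EuclideanSpace ℝ (Fin (k + 1)) :=
    (MeasurableEquiv.piFinSuccAbove (fun _ => ℝ) i).symm.trans
      (MeasurableEquiv.toLp 2 (Fin (k + 1) → ℝ))
  have he : MeasurePreserving e volume volume :=
    (PiLp.volume_preserving_toLp _).comp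
      (volume_preserving_piFinSuccAbove (fun _ : Fin (k + 1) => ℝ) i).symm
  have hsub : S ⊆ e ⁻¹' sphereCone A := by
    rintro ⟨t, u⟩ ⟨ht, hw, hwA⟩
    have hpos : 0 < s * t := hc0.trans ht.1
    have := mem_sphereCone_of_smul_sphereChart hs hw hwA hpos (ht.2.trans_eq (by rw [hc]; ring))
    suffices h : e (t, u) = (s * t) • affineChart i s ((s * t)⁻¹ • u) by
      rw [mem_preimage, h]; exact this
    change WithLp.toLp 2 (i.insertNth t u : Fin (k + 1) → ℝ) = _
    ext j
    induction j using i.succAboveCases with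
    | x => simp [affineChart]; linear_combination (-t) * hss
    | p j =>
      have : s * t * ((s * t)⁻¹ * u j) = u j := mul_inv_cancel_left₀ hpos.ne' _
      simpa [affineChart] using this.symm
  have hfib : ∀ t, s * t ∈ Ioo c (2 * c) →
      ENNReal.ofReal c ^ k * volume W ≤ volume (Prod.mk t ⁻¹' S) := by
    intro t ht
    have hpos : 0 < s * t := hc0.trans ht.1
    have : Prod.mk t ⁻¹' S = (fun u => (s * t)⁻¹ • u) ⁻¹' W := by
      ext u
      exact and_iff_right ht
    rw [this, Measure.addHaar_preimage_smul _ (inv_ne_zero hpos.ne'), Module.finrank_fin_fun,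
      inv_pow, inv_inv, abs_of_nonneg (by positivity), ← ENNReal.ofReal_pow hc0.le]
    gcongr
    exact ht.1.le
  have hI : volume {t : ℝ | s * t ∈ Ioo c (2 * c)} = ENNReal.ofReal c := by
    have := Real.volume_preimage_mul_left (a := s) (by rintro rfl; simp at hs) (Ioo c (2 * c))
    rw [Real.volume_Ioo, abs_inv, hs, inv_one, ENNReal.ofReal_one, one_mul, two_mul,
      add_sub_cancel_right] at this
    rw [two_mul]
    exact this
  calc ENNReal.ofReal c ^ (k + 1) * volume W
      = (ENNReal.ofReal c ^ k * volume W) * volume {t : ℝ | s * t ∈ Ioo c (2 * c)} := by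
        rw [hI]; ring
    _ = ∫⁻ _ in {t : ℝ | s * t ∈ Ioo c (2 * c)}, ENNReal.ofReal c ^ k * volume W := by
        rw [setLIntegral_const]
    _ ≤ ∫⁻ t in {t : ℝ | s * t ∈ Ioo c (2 * c)}, volume (Prod.mk t ⁻¹' S) :=
        setLIntegral_mono' ((measurable_const_mul s) measurableSet_Ioo) hfib
    _ ≤ ∫⁻ t, volume (Prod.mk t ⁻¹' S) := setLIntegral_le_lintegral _ _
    _ = volume S := (Measure.prod_apply hSm).symm
    _ ≤ volume (e ⁻¹' sphereCone A) := measure_mono hsub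
    _ = volume (sphereCone A) := he.measure_preimage_equiv _

lemma exists_sphereChart_eq (θ : Metric.sphere (0 : EuclideanSpace ℝ (Fin (k + 1))) 1) :
    ∃ i : Fin (k + 1), ∃ b : Bool, ∃ w : Fin k → ℝ, (∀ j, |w j| ≤ 1) ∧
      sphereChart i (if b then 1 else -1) w = θ := by
  obtain ⟨i, hi⟩ := Finite.exists_max fun i => |θ.1 i|
  have hθ : ‖θ.1‖ = 1 := by simp
  have hpos : 0 < |θ.1 i| := by
    by_contra! h
    have : θ.1 = 0 := by
      ext j
      exact abs_eq_zero.1 (le_antisymm ((hi j).trans h) (abs_nonneg _))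
    simp [this] at hθ
  refine ⟨i, decide (0 < θ.1 i), fun j => |θ.1 i|⁻¹ * θ.1 (i.succAbove j), fun j => ?_, ?_⟩
  · rw [abs_mul, abs_inv, abs_abs, ← div_eq_inv_mul]
    exact div_le_one_of_le₀ (hi _) hpos.le
  · set s : ℝ := if decide (0 < θ.1 i) = true then 1 else -1 with hs
    have hs1 : |s| = 1 := by rw [hs]; split_ifs <;> simp
    have hsθ : s = |θ.1 i|⁻¹ * θ.1 i := by
      have hne := abs_pos.1 hpos
      by_cases h : 0 < θ.1 i
      · simp [hs, h, abs_of_pos h, hne]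
      · have h' : θ.1 i < 0 := lt_of_le_of_ne (not_lt.1 h) hne
        simp [hs, h, abs_of_neg h', hne]
    have hchart : affineChart i s (fun j => |θ.1 i|⁻¹ * θ.1 (i.succAbove j)) =
        |θ.1 i|⁻¹ • θ.1 := by
      ext j
      induction j using i.succAboveCases with
      | x => simp [affineChart, hsθ]
      | p j => simp [affineChart]
    ext1
    rw [sphereChart, coe_sphereProj (affineChart_ne_zero i hs1 _), hchart, norm_smul, hθ]
    simp [smul_smul, hpos.ne']

/-- The Hausdorff measure on the sphere is dominated by the surface measure defined by cones. -/
lemma exists_hausdorffMeasure_sphere_le (k : ℕ) : ∃ C : ℝ≥0∞, C ≠ ∞ ∧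
    ∀ A : Set (Metric.sphere (0 : EuclideanSpace ℝ (Fin (k + 1))) 1), MeasurableSet A →
      μH[(k : ℝ)] A ≤ C * volume (sphereCone A) := by
  set a := ENNReal.ofReal ((euclideanConst k : ℝ)⁻¹ / 2) ^ (k + 1) with ha
  have hK : (0 : ℝ) < euclideanConst k := euclideanConst_pos k
  have ha0 : a ≠ 0 := pow_ne_zero _ (by simpa using euclideanConst_pos k)
  have hat : a ≠ ∞ := ENNReal.pow_ne_top ENNReal.ofReal_ne_top
  set L : ℝ≥0∞ := ((2 * euclideanConst k : ℝ≥0) : ℝ≥0∞) ^ (k : ℝ) with hL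
  have hLt : L ≠ ∞ := ENNReal.rpow_ne_top_of_nonneg (by positivity) ENNReal.coe_ne_top
  refine ⟨∑ _i : Fin (k + 1), ∑ _b : Bool, L * a⁻¹, ?_, fun A hA => ?_⟩
  · exact ENNReal.sum_ne_top.2 fun _ _ => ENNReal.sum_ne_top.2 fun _ _ =>
      ENNReal.mul_ne_top hLt (ENNReal.inv_ne_top.2 ha0)
  let s : Bool → ℝ := fun b => if b then 1 else -1
  have hs : ∀ b, |s b| = 1 := by intro b; cases b <;> simp [s]
  let W : Fin (k + 1) → Bool → Set (Fin k → ℝ) := fun i b =>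
    {w | (∀ j, |w j| ≤ 1) ∧ sphereChart i (s b) w ∈ A}
  have hcov : A ⊆ ⋃ i, ⋃ b, sphereChart i (s b) '' W i b := by
    intro θ hθ
    obtain ⟨i, b, w, hw, h⟩ := exists_sphereChart_eq θ
    exact mem_iUnion₂.2 ⟨i, b, w, ⟨hw, by rw [h]; exact hθ⟩, h⟩
  have hpiece : ∀ i b, μH[(k : ℝ)] (sphereChart i (s b) '' W i b) ≤
      L * a⁻¹ * volume (sphereCone A) := by
    intro i b
    have h1 := (lipschitzWith_sphereChart i (hs b)).hausdorffMeasure_image_le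
      (Nat.cast_nonneg k) (W i b)
    have h2 : (μH[(k : ℝ)] : Measure (Fin k → ℝ)) = volume := by
      simpa using hausdorffMeasure_pi_real (ι := Fin k)
    rw [h2] at h1
    have h3 : volume (W i b) ≤ a⁻¹ * volume (sphereCone A) := by
      rw [← ENNReal.div_eq_inv_mul, ENNReal.le_div_iff_mul_le (Or.inl ha0) (Or.inl hat), mul_comm]
      exact volume_chart_le i (hs b) hA
    calc _ ≤ L * volume (W i b) := h1
      _ ≤ L * (a⁻¹ * volume (sphereCone A)) := by gcongr
      _ = _ := by rw [mul_assoc]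
  calc μH[(k : ℝ)] A ≤ μH[(k : ℝ)] (⋃ i, ⋃ b, sphereChart i (s b) '' W i b) := measure_mono hcov
    _ ≤ ∑ i, ∑ b, μH[(k : ℝ)] (sphereChart i (s b) '' W i b) := by
        refine (measure_iUnion_fintype_le _ _).trans ?_
        gcongr
        exact measure_iUnion_fintype_le _ _
    _ ≤ ∑ _i : Fin (k + 1), ∑ _b : Bool, L * a⁻¹ * volume (sphereCone A) := by
        gcongr; exact hpiece _ _
    _ = _ := by simp only [Finset.sum_mul]

end SphereChart

lemma volume_sphereCone_lt_le {n : ℕ} {L : EuclideanSpace ℝ (Fin n) →L[ℝ] EuclideanSpace ℝ (Fin n)}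
    (hL : LinearMap.det (L : EuclideanSpace ℝ (Fin n) →ₗ[ℝ] EuclideanSpace ℝ (Fin n)) = 1)
    (r : ℝ) : volume (sphereCone {θ | ‖L θ.1‖ < r}) ≤
      volume (Metric.ball (0 : EuclideanSpace ℝ (Fin n)) r) := by
  have h := Measure.addHaar_preimage_linearMap volume
    (f := (L : EuclideanSpace ℝ (Fin n) →ₗ[ℝ] EuclideanSpace ℝ (Fin n)))
    (by rw [hL]; exact one_ne_zero) (Metric.ball 0 r)
  rw [hL, inv_one, abs_one, ENNReal.ofReal_one, one_mul] at h
  rw [← h]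
  refine measure_mono ?_
  rintro _ ⟨a, ha, _, ⟨θ, hθ, rfl⟩, rfl⟩
  simp only [mem_preimage, Metric.mem_ball, dist_zero_right, ContinuousLinearMap.coe_coe,
    map_smul, norm_smul, Real.norm_eq_abs, abs_of_pos ha.1]
  exact (mul_le_of_le_one_left (norm_nonneg _) ha.2.le).trans_lt hθ

lemma volume_sphereCone_le_le {n : ℕ} {L : EuclideanSpace ℝ (Fin n) →L[ℝ] EuclideanSpace ℝ (Fin n)}
    {c : ℝ} {N : ℕ} (hN : 0 < N) {u : EuclideanSpace ℝ (Fin n)} (hu : ‖u‖ ≤ 1)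
    (hLu : 2 * c * N < ‖L u‖) :
    N * volume (sphereCone {θ | ‖L θ.1‖ ≤ c}) ≤
      volume (Metric.ball (0 : EuclideanSpace ℝ (Fin n)) 2) := by
  have hN' : (0 : ℝ) < N := by exact_mod_cast hN
  set K : Set (EuclideanSpace ℝ (Fin n)) := Metric.ball 0 1 ∩ {v | ‖L v‖ ≤ c}
  have hKm : MeasurableSet K :=
    Metric.isOpen_ball.measurableSet.inter (measurableSet_le (by fun_prop) measurable_const)
  have hsub : sphereCone {θ | ‖L θ.1‖ ≤ c} ⊆ K := by
    rintro _ ⟨a, ha, _, ⟨θ, hθ, rfl⟩, rfl⟩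
    have hθ1 : ‖(θ : EuclideanSpace ℝ (Fin n))‖ = 1 := by simp
    refine ⟨?_, ?_⟩
    · simpa [norm_smul, abs_of_pos ha.1] using ha.2
    · simp only [mem_ofPred_eq, map_smul, norm_smul, Real.norm_eq_abs, abs_of_pos ha.1]
      exact (mul_le_of_le_one_left (norm_nonneg _) ha.2.le).trans hθ
  let τ : ℕ → Set (EuclideanSpace ℝ (Fin n)) := fun i => (fun v => v + ((i : ℝ) / N) • u) ⁻¹' K
  have hτ : ∀ i, volume (τ i) = volume K := fun i => measure_preimage_add_right _ _ _
  have hdisj : Set.PairwiseDisjoint (Finset.range N : Set ℕ) τ := by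
    intro i _ j _ hij
    refine Set.disjoint_left.2 fun v hi hj => ?_
    have h1 : ‖L (v + ((i : ℝ) / N) • u)‖ ≤ c := hi.2
    have h2 : ‖L (v + ((j : ℝ) / N) • u)‖ ≤ c := hj.2
    have h3 : L (v + ((i : ℝ) / N) • u) - L (v + ((j : ℝ) / N) • u) =
        (((i : ℝ) - j) / N) • L u := by
      rw [← map_sub, ← map_smul]; congr 1; module
    have h4 : ‖(((i : ℝ) - j) / N) • L u‖ ≤ 2 * c := by
      rw [← h3]; linarith [norm_sub_le (L (v + ((i : ℝ) / N) • u)) (L (v + ((j : ℝ) / N) • u))]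
    have h5 : (1 : ℝ) ≤ |(i : ℝ) - j| := by
      have : (1 : ℤ) ≤ |(i : ℤ) - j| := Int.one_le_abs (by omega)
      exact_mod_cast this
    rw [norm_smul, Real.norm_eq_abs, abs_div, abs_of_pos hN', div_mul_eq_mul_div,
      div_le_iff₀ hN'] at h4
    nlinarith [norm_nonneg (L u)]
  have hball : (⋃ i ∈ Finset.range N, τ i) ⊆ Metric.ball 0 2 := by
    refine iUnion₂_subset fun i hi v hv => ?_
    have h1 : ‖v + ((i : ℝ) / N) • u‖ < 1 := by simpa using hv.1
    have hi' : (i : ℝ) ≤ N := by exact_mod_cast (Finset.mem_range.1 hi).le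
    have h2 : ‖((i : ℝ) / N) • u‖ ≤ 1 := by
      rw [norm_smul, Real.norm_of_nonneg (by positivity)]
      exact mul_le_one₀ (div_le_one_of_le₀ hi' hN'.le) (norm_nonneg _) hu
    have h3 := norm_sub_le (v + ((i : ℝ) / N) • u) (((i : ℝ) / N) • u)
    rw [add_sub_cancel_right] at h3
    rw [Metric.mem_ball, dist_zero_right]
    linarith
  calc N * volume (sphereCone {θ | ‖L θ.1‖ ≤ c}) ≤ N * volume K := by gcongr
    _ = ∑ i ∈ Finset.range N, volume (τ i) := by simp [hτ]
    _ = volume (⋃ i ∈ Finset.range N, τ i) :=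
        (measure_biUnion_finset hdisj fun i _ => (measurable_add_const _) hKm).symm
    _ ≤ _ := measure_mono hball

lemma ae_quadratic_ne_zero {E : Type*} [NormedAddCommGroup E] [NormedSpace ℝ E]
    [FiniteDimensional ℝ E] [MeasurableSpace E] [BorelSpace E] (μ : Measure E)
    [μ.IsAddHaarMeasure] (B : E →ₗ[ℝ] E →ₗ[ℝ] E) (hB : ∃ x, B x x ≠ 0) :
    ∀ᵐ x ∂μ, B x x ≠ 0 := by
  obtain ⟨e, he⟩ := hB
  obtain ⟨φ, hφ⟩ := (Module.forall_dual_apply_eq_zero_iff ℝ (B e e)).not.2 he |> not_forall.1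
  have hcont : Continuous fun x => B x x :=
    (B.toContinuousBilinearMap.continuous₂).comp (continuous_id.prodMk continuous_id)
  refine ae_mem_of_ae_add_linearMap_mem (LinearMap.toSpanSingleton ℝ E e) volume μ
    (s := {x | B x x ≠ 0}) (isOpen_ne_fun hcont continuous_const).measurableSet fun y => ?_
  let p : Polynomial ℝ := Polynomial.C (φ (B e e)) * Polynomial.X ^ 2 +
    Polynomial.C (φ (B y e) + φ (B e y)) * Polynomial.X + Polynomial.C (φ (B y y))
  have hp : p ≠ 0 := by
    intro h
    have := congrArg (fun q => Polynomial.coeff q 2) h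
    simp [p, hφ] at this
  have hfin : (p.roots.toFinset : Set ℝ).Finite := Finset.finite_toSet _
  filter_upwards [measure_eq_zero_iff_ae_notMem.1 (hfin.measure_zero volume)] with t ht h0
  apply ht
  simp only [Finset.mem_coe, Multiset.mem_toFinset, Polynomial.mem_roots hp, Polynomial.IsRoot]
  have := congrArg φ h0
  simp only [LinearMap.toSpanSingleton_apply, map_add, map_smul, LinearMap.add_apply,
    LinearMap.smul_apply, smul_eq_mul, map_zero] at this
  simp only [p, Polynomial.eval_add, Polynomial.eval_mul, Polynomial.eval_C, Polynomial.eval_pow,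
    Polynomial.eval_X]
  linear_combination this

/-- Quantitative recurrence for a measure preserving semiflow of a probability space. -/
lemma exists_le_measure_inter_preimage {α : Type*} [MeasurableSpace α] {ν : Measure α}
    [IsProbabilityMeasure ν] {F : ℝ → α → α} (hF : ∀ t, 0 ≤ t → MeasurePreserving (F t) ν ν)
    (hsemi : ∀ s t, 0 ≤ s → 0 ≤ t → ∀ x, F (s + t) x = F s (F t x)) {G : Set α}
    (hG : MeasurableSet G) (hG0 : ν G ≠ 0) :
    ∃ ε : ℝ≥0∞, 0 < ε ∧ ∀ T : ℝ, ∃ t ≥ T, ε ≤ ν (G ∩ F t ⁻¹' G) := by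
  obtain ⟨N, hN⟩ := ENNReal.exists_nat_gt (ENNReal.div_ne_top ENNReal.ofNat_ne_top hG0 : 3 / ν G ≠ ∞)
  have hN0 : (N : ℝ≥0∞) ≠ 0 := (pos_of_gt hN).ne'
  have hNG : 3 ≤ N * ν G := ((ENNReal.div_lt_iff (Or.inl hG0)
    (Or.inl (measure_ne_top _ _))).1 hN).le
  refine ⟨((N : ℝ≥0∞) ^ 2)⁻¹, by simp, fun T => ?_⟩
  by_contra! hcon
  set T' := max T 0
  have hT' : 0 ≤ T' := le_max_right _ _
  let A : ℕ → Set α := fun i => F (i * T') ⁻¹' G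
  have hAm : ∀ i, MeasurableSet (A i) := fun i => (hF _ (by positivity)).measurable hG
  have hA : ∀ i, ν (A i) = ν G := fun i =>
    (hF _ (by positivity)).measure_preimage hG.nullMeasurableSet
  have hAA : ∀ i j, i < j → ν (A i ∩ A j) ≤ ((N : ℝ≥0∞) ^ 2)⁻¹ := by
    intro i j hij
    have hd : T' ≤ ((j : ℝ) - i) * T' := by
      refine le_mul_of_one_le_left hT' ?_
      have : ((i + 1 : ℕ) : ℝ) ≤ j := by exact_mod_cast hij
      push_cast at this
      linarith
    have hset : A i ∩ A j = F (i * T') ⁻¹' (G ∩ F (((j : ℝ) - i) * T') ⁻¹' G) := by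
      ext x
      have := hsemi (((j : ℝ) - i) * T') (i * T') (hT'.trans hd) (by positivity) x
      rw [← add_mul, sub_add_cancel] at this
      simp only [A, mem_inter_iff, mem_preimage, this]
    rw [hset, (hF _ (by positivity)).measure_preimage
      (hG.inter ((hF _ (hT'.trans hd)).measurable hG)).nullMeasurableSet]
    exact (hcon _ ((le_max_left _ _).trans hd)).le
  have key : ∀ m ≤ N, m * ν G ≤ ν (⋃ i ∈ Finset.range m, A i) +
      m * (N * ((N : ℝ≥0∞) ^ 2)⁻¹) := by
    intro m
    induction m with
    | zero => simp
    | succ m ih =>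
      intro hm
      have hU := measure_union_add_inter (μ := ν) (⋃ i ∈ Finset.range m, A i) (hAm m)
      have hI : ν ((⋃ i ∈ Finset.range m, A i) ∩ A m) ≤ N * ((N : ℝ≥0∞) ^ 2)⁻¹ := by
        rw [iUnion₂_inter]
        calc ν (⋃ i ∈ Finset.range m, A i ∩ A m) ≤ ∑ i ∈ Finset.range m, ν (A i ∩ A m) :=
              measure_biUnion_finset_le _ _
          _ ≤ ∑ i ∈ Finset.range m, ((N : ℝ≥0∞) ^ 2)⁻¹ :=
              Finset.sum_le_sum fun i hi => hAA i m (Finset.mem_range.1 hi)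
          _ = m * ((N : ℝ≥0∞) ^ 2)⁻¹ := by simp
          _ ≤ _ := by gcongr; omega
      have hsucc : (⋃ i ∈ Finset.range (m + 1), A i) = (⋃ i ∈ Finset.range m, A i) ∪ A m := by
        rw [Finset.range_add_one, Finset.set_biUnion_insert, union_comm]
      rw [hsucc]
      push_cast
      calc ((m : ℝ≥0∞) + 1) * ν G = m * ν G + ν (A m) := by rw [hA]; ring
        _ ≤ ν (⋃ i ∈ Finset.range m, A i) + m * (N * ((N : ℝ≥0∞) ^ 2)⁻¹) + ν (A m) := by
            gcongr; exact ih (by omega)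
        _ = ν ((⋃ i ∈ Finset.range m, A i) ∪ A m) + ν ((⋃ i ∈ Finset.range m, A i) ∩ A m) +
            m * (N * ((N : ℝ≥0∞) ^ 2)⁻¹) := by rw [hU]; ring
        _ ≤ ν ((⋃ i ∈ Finset.range m, A i) ∪ A m) + N * ((N : ℝ≥0∞) ^ 2)⁻¹ +
            m * (N * ((N : ℝ≥0∞) ^ 2)⁻¹) := by gcongr
        _ = _ := by ring
  have h1 := key N le_rfl
  rw [← mul_assoc, ← sq, ENNReal.mul_inv_cancel (pow_ne_zero 2 hN0)
    (ENNReal.pow_ne_top (ENNReal.natCast_ne_top N))] at h1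
  have h2 : (3 : ℝ≥0∞) ≤ 1 + 1 := hNG.trans (h1.trans (by gcongr; exact prob_le_one))
  norm_num at h2

lemma exists_dominated_set_of_not_mutuallySingular {α : Type*} [MeasurableSpace α]
    {ν μ : Measure α} [IsFiniteMeasure ν] [SigmaFinite μ] (h : ¬ ν ⟂ₘ μ) {H : ℕ → Set α}
    (hHm : ∀ k, MeasurableSet (H k)) (hmono : Monotone H) (hH : ∀ᵐ x ∂μ, ∃ k, x ∈ H k) :
    ∃ k : ℕ, ∃ G ⊆ H k, MeasurableSet G ∧ ν G ≠ 0 ∧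
      ∀ A, MeasurableSet A → ν (A ∩ G) ≤ k * μ A := by
  set f := ν.rnDeriv μ
  obtain ⟨Z, hZm, hZ, hZc⟩ := Measure.mutuallySingular_singularPart ν μ
  have hf : Measurable f := Measure.measurable_rnDeriv ν μ
  let G : ℕ → Set α := fun k => Z ∩ {x | f x ≤ k} ∩ H k
  have hGm : ∀ k, MeasurableSet (G k) := fun k =>
    (hZm.inter (measurableSet_le hf measurable_const)).inter (hHm k)
  have hdom : ∀ k A, MeasurableSet A → ν (A ∩ G k) ≤ k * μ A := by
    intro k A hA
    conv_lhs => rw [Measure.haveLebesgueDecomposition_add ν μ]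
    rw [Measure.add_apply, measure_mono_null (fun x hx => hx.2.1.1) hZ, zero_add,
      withDensity_apply _ (hA.inter (hGm k))]
    calc ∫⁻ x in A ∩ G k, f x ∂μ ≤ ∫⁻ _ in A ∩ G k, k ∂μ :=
          setLIntegral_mono' (hA.inter (hGm k)) fun x hx => hx.2.1.2
      _ = k * μ (A ∩ G k) := setLIntegral_const _ _
      _ ≤ k * μ A := by gcongr; exact inter_subset_left
  by_contra! hcon
  have hzero : ∀ k, ν (G k) = 0 := by
    intro k
    by_contra h0
    obtain ⟨A, hA, hlt⟩ := hcon k (G k) inter_subset_right (hGm k) h0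
    exact hlt.not_ge (hdom k A hA)
  refine h ⟨⋃ k, G k, MeasurableSet.iUnion hGm, measure_iUnion_null hzero, ?_⟩
  rw [measure_eq_zero_iff_ae_notMem]
  filter_upwards [hH, Measure.rnDeriv_lt_top ν μ, measure_eq_zero_iff_ae_notMem.1 hZc]
    with x ⟨k, hk⟩ hfx hxZ hx
  obtain ⟨m, hm⟩ := ENNReal.exists_nat_gt hfx.ne
  refine hx (mem_iUnion.2 ⟨max k m, ⟨not_not.1 hxZ, ?_⟩, hmono (le_max_left _ _) hk⟩)
  exact hm.le.trans (by exact_mod_cast le_max_right k m)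

section QuadraticFlow

variable {E : Type*} [NormedAddCommGroup E] [NormedSpace ℝ E] {B : E →ₗ[ℝ] E →ₗ[ℝ] E}
  {Φ : ℝ → E → E} {D : ℝ → E → E →L[ℝ] E}

lemma quadratic_flow_smul
    (hderiv : ∀ (x : E) (t : ℝ), 0 ≤ t →
      HasDerivWithinAt (fun s => Φ s x) (B (Φ t x) (Φ t x)) (Ici 0) t)
    (huniq : ∀ (x : E) (y : ℝ → E), y 0 = x →
      (∀ t : ℝ, 0 ≤ t → HasDerivWithinAt y (B (y t) (y t)) (Ici 0) t) → ∀ t : ℝ, 0 ≤ t → y t = Φ t x)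
    (h0 : ∀ x, Φ 0 x = x) {a : ℝ} (ha : 0 ≤ a) {t : ℝ} (ht : 0 ≤ t) (x : E) :
    a • Φ (a * t) x = Φ t (a • x) := by
  refine huniq (a • x) (fun s => a • Φ (a * s) x) (by simp [h0]) (fun s hs => ?_) t ht
  have h1 : HasDerivWithinAt (fun s : ℝ => a * s) a (Ici 0) s := by
    simpa using ((hasDerivAt_id s).const_mul a).hasDerivWithinAt
  have h2 : HasDerivWithinAt (fun s => a • Φ (a * s) x) _ (Ici 0) s :=
    ((hderiv x (a * s) (mul_nonneg ha hs)).scomp s h1 (fun r hr => mul_nonneg ha hr)).const_smul a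
  exact h2.congr_deriv (by simp)

lemma quadratic_flow_fderiv_self
    (hderiv : ∀ (x : E) (t : ℝ), 0 ≤ t →
      HasDerivWithinAt (fun s => Φ s x) (B (Φ t x) (Φ t x)) (Ici 0) t)
    (huniq : ∀ (x : E) (y : ℝ → E), y 0 = x →
      (∀ t : ℝ, 0 ≤ t → HasDerivWithinAt y (B (y t) (y t)) (Ici 0) t) → ∀ t : ℝ, 0 ≤ t → y t = Φ t x)
    (h0 : ∀ x, Φ 0 x = x) (hD : ∀ t : ℝ, 0 ≤ t → ∀ x, HasFDerivAt (Φ t) (D t x) x)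
    {t : ℝ} (ht : 0 < t) (x : E) : D t x x = Φ t x + t • B (Φ t x) (Φ t x) := by
  have h1 : HasDerivAt (fun a : ℝ => Φ t (a • x)) (D t x x) 1 := by
    have hx : HasDerivAt (fun a : ℝ => a • x) x 1 := by
      simpa using (hasDerivAt_id (1 : ℝ)).smul_const x
    have hDx : HasFDerivAt (Φ t) (D t x) ((1 : ℝ) • x) := by simpa using hD t ht.le x
    exact hDx.comp_hasDerivAt 1 hx
  have h2 : HasDerivAt (fun a : ℝ => a • Φ (a * t) x) (Φ t x + t • B (Φ t x) (Φ t x)) 1 := by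
    have hm : HasDerivAt (fun a : ℝ => a * t) t 1 := by
      simpa using (hasDerivAt_id (1 : ℝ)).mul_const t
    have hΦ : HasDerivAt (fun s => Φ s x) (B (Φ t x) (Φ t x)) (1 * t) := by
      simpa using (hderiv x t ht.le).hasDerivAt (Ici_mem_nhds ht)
    have hc : HasDerivAt (fun a : ℝ => Φ (a * t) x) (t • B (Φ t x) (Φ t x)) 1 :=
      HasDerivAt.scomp (h := fun a : ℝ => a * t) (1 : ℝ) hΦ hm
    have h : HasDerivAt (fun a : ℝ => a • Φ (a * t) x) _ 1 := (hasDerivAt_id (1 : ℝ)).smul hc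
    exact h.congr_deriv (by simp [add_comm])
  refine h1.unique (h2.congr_of_eventuallyEq ?_)
  filter_upwards [lt_mem_nhds (zero_lt_one' ℝ)] with a ha
  exact (quadratic_flow_smul hderiv huniq h0 ha.le ht.le x).symm

lemma quadratic_flow_reverse
    (hderiv : ∀ (x : E) (t : ℝ), 0 ≤ t →
      HasDerivWithinAt (fun s => Φ s x) (B (Φ t x) (Φ t x)) (Ici 0) t)
    (huniq : ∀ (x : E) (y : ℝ → E), y 0 = x →
      (∀ t : ℝ, 0 ≤ t → HasDerivWithinAt y (B (y t) (y t)) (Ici 0) t) → ∀ t : ℝ, 0 ≤ t → y t = Φ t x)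
    (h0 : ∀ x, Φ 0 x = x) {t : ℝ} (ht : 0 ≤ t) (x : E) : Φ t (-Φ t x) = -x := by
  let y : ℝ → E := fun s => if s ≤ t then -Φ (t - s) x else Φ (s - t) (-x)
  have hyl : ∀ s ≤ t, y s = -Φ (t - s) x := fun s hs => if_pos hs
  have hyr : ∀ s ≥ t, y s = Φ (s - t) (-x) := by
    intro s hs
    rcases hs.eq_or_lt with rfl | h
    · simp [y, h0]
    · exact if_neg h.not_ge
  have hl : ∀ s ≤ t, HasDerivWithinAt y (B (y s) (y s)) (Iic t) s := by
    intro s hs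
    have h1 : HasDerivWithinAt (fun r : ℝ => t - r) (-1) (Iic t) s :=
      ((hasDerivAt_id s).const_sub t).hasDerivWithinAt
    have h2 : HasDerivWithinAt (fun r => -Φ (t - r) x) _ (Iic t) s :=
      ((hderiv x (t - s) (sub_nonneg.2 hs)).scomp s h1
        (fun r hr => mem_Ici.2 (sub_nonneg.2 hr))).neg
    rw [hyl s hs]
    refine HasDerivWithinAt.congr ?_ (fun r hr => hyl r hr) (hyl s hs)
    exact h2.congr_deriv (by simp)
  have hr : ∀ s ≥ t, HasDerivWithinAt y (B (y s) (y s)) (Ici t) s := by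
    intro s hs
    have h1 : HasDerivWithinAt (fun r : ℝ => r - t) 1 (Ici t) s :=
      ((hasDerivAt_id s).sub_const t).hasDerivWithinAt
    have h2 := (hderiv (-x) (s - t) (sub_nonneg.2 hs)).scomp s h1 (fun r hr => mem_Ici.2 (sub_nonneg.2 hr))
    rw [hyr s hs]
    refine HasDerivWithinAt.congr ?_ (fun r hr => hyr r hr) (hyr s hs)
    exact h2.congr_deriv (by simp)
  have hy : ∀ s, HasDerivAt y (B (y s) (y s)) s := by
    intro s
    rcases lt_trichotomy s t with h | rfl | h
    · exact (hl s h.le).hasDerivAt (Iic_mem_nhds h)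
    · simpa using (hl s le_rfl).union (hr s le_rfl)
    · exact (hr s h.le).hasDerivAt (Ici_mem_nhds h)
  have := huniq (-Φ t x) y (by simp [hyl 0 ht]) (fun s _ => (hy s).hasDerivWithinAt) t ht
  rw [← this, hyl t le_rfl, sub_self, h0]

lemma quadratic_flow_fderiv_reverse
    (hderiv : ∀ (x : E) (t : ℝ), 0 ≤ t →
      HasDerivWithinAt (fun s => Φ s x) (B (Φ t x) (Φ t x)) (Ici 0) t)
    (huniq : ∀ (x : E) (y : ℝ → E), y 0 = x →
      (∀ t : ℝ, 0 ≤ t → HasDerivWithinAt y (B (y t) (y t)) (Ici 0) t) → ∀ t : ℝ, 0 ≤ t → y t = Φ t x)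
    (h0 : ∀ x, Φ 0 x = x) (hD : ∀ t : ℝ, 0 ≤ t → ∀ x, HasFDerivAt (Φ t) (D t x) x)
    {t : ℝ} (ht : 0 ≤ t) (x v : E) : D t (-Φ t x) (D t x v) = v := by
  have h1 := (hD t ht (-Φ t x)).comp x (hD t ht x).neg
  have h2 : HasFDerivAt (Φ t ∘ fun x => -Φ t x) (-ContinuousLinearMap.id ℝ E) x := by
    have : (Φ t ∘ fun x => -Φ t x) = fun x => -x :=
      funext fun x => quadratic_flow_reverse hderiv huniq h0 ht x
    rw [this]
    exact (hasFDerivAt_id x).neg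
  simpa using congrArg (fun L : E →L[ℝ] E => L v) (h1.unique h2)

lemma semiflow_fderiv_cocycle
    (hsemi : ∀ s t : ℝ, 0 ≤ s → 0 ≤ t → ∀ x, Φ (s + t) x = Φ s (Φ t x))
    (hD : ∀ t : ℝ, 0 ≤ t → ∀ x, HasFDerivAt (Φ t) (D t x) x)
    {s t : ℝ} (hs : 0 ≤ s) (ht : 0 ≤ t) (x v : E) :
    D (s + t) x v = D s (Φ t x) (D t x v) := by
  have h1 := (hD s hs (Φ t x)).comp x (hD t ht x)
  rw [show Φ s ∘ Φ t = Φ (s + t) from funext fun x => (hsemi s t hs ht x).symm] at h1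
  rw [(hD _ (add_nonneg hs ht) x).unique h1]
  rfl

end QuadraticFlow

section ProjectiveFlow

variable {n : ℕ} {Φ : ℝ → EuclideanSpace ℝ (Fin n) → EuclideanSpace ℝ (Fin n)}
  {D : ℝ → EuclideanSpace ℝ (Fin n) → EuclideanSpace ℝ (Fin n) →L[ℝ] EuclideanSpace ℝ (Fin n)}

lemma apply_ne_zero_of_det_eq_one
    {L : EuclideanSpace ℝ (Fin n) →L[ℝ] EuclideanSpace ℝ (Fin n)}
    (hL : LinearMap.det (L : EuclideanSpace ℝ (Fin n) →ₗ[ℝ] EuclideanSpace ℝ (Fin n)) = 1)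
    {v : EuclideanSpace ℝ (Fin n)} (hv : v ≠ 0) : L v ≠ 0 := by
  have h := ((L : EuclideanSpace ℝ (Fin n) →ₗ[ℝ] EuclideanSpace ℝ (Fin n)).equivOfDetNeZero
    (by rw [hL]; exact one_ne_zero)).map_ne_zero_iff.2 hv
  exact h

/-- The projective flow on `ℝⁿ × Sⁿ⁻¹`. -/
noncomputable def projectiveFlow
    (Φ : ℝ → EuclideanSpace ℝ (Fin n) → EuclideanSpace ℝ (Fin n))
    (D : ℝ → EuclideanSpace ℝ (Fin n) → EuclideanSpace ℝ (Fin n) →L[ℝ] EuclideanSpace ℝ (Fin n))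
    (t : ℝ) (p : EuclideanSpace ℝ (Fin n) × Metric.sphere (0 : EuclideanSpace ℝ (Fin n)) 1) :
    EuclideanSpace ℝ (Fin n) × Metric.sphere (0 : EuclideanSpace ℝ (Fin n)) 1 :=
  (Φ t p.1, sphereProj (D t p.1 p.2.val) p.2)

lemma continuous_fderiv_flow {t : ℝ} (hC1 : ContDiff ℝ 1 (Φ t))
    (hD : ∀ x, HasFDerivAt (Φ t) (D t x) x) : Continuous (D t) := by
  have : D t = fderiv ℝ (Φ t) := funext fun x => (hD x).fderiv.symm
  rw [this]
  exact hC1.continuous_fderiv one_ne_zero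

lemma sphere_coe_ne_zero (v : Metric.sphere (0 : EuclideanSpace ℝ (Fin n)) 1) :
    (v : EuclideanSpace ℝ (Fin n)) ≠ 0 :=
  norm_ne_zero_iff.1 (by simp)

lemma measurable_projectiveFlow {t : ℝ} (hC1 : ContDiff ℝ 1 (Φ t))
    (hD : ∀ x, HasFDerivAt (Φ t) (D t x) x)
    (hdet : ∀ x, LinearMap.det
      ((D t x) : EuclideanSpace ℝ (Fin n) →ₗ[ℝ] EuclideanSpace ℝ (Fin n)) = 1) :
    Measurable (projectiveFlow Φ D t) := by
  have hDc := continuous_fderiv_flow hC1 hD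
  have hne : ∀ p : EuclideanSpace ℝ (Fin n) × Metric.sphere (0 : EuclideanSpace ℝ (Fin n)) 1,
      D t p.1 p.2.val ≠ 0 := fun p => apply_ne_zero_of_det_eq_one (hdet _) (sphere_coe_ne_zero _)
  have hDp : Continuous fun p : EuclideanSpace ℝ (Fin n) ×
      Metric.sphere (0 : EuclideanSpace ℝ (Fin n)) 1 => D t p.1 p.2.val :=
    (hDc.comp continuous_fst).clm_apply (continuous_subtype_val.comp continuous_snd)
  refine Continuous.measurable ((hC1.continuous.comp continuous_fst).prodMk ?_)
  refine continuous_induced_rng.2 ?_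
  have : Continuous fun p : EuclideanSpace ℝ (Fin n) ×
      Metric.sphere (0 : EuclideanSpace ℝ (Fin n)) 1 =>
      ‖D t p.1 p.2.val‖⁻¹ • D t p.1 p.2.val :=
    (hDp.norm.inv₀ fun p => norm_ne_zero_iff.2 (hne p)).smul hDp
  exact this.congr fun p => (coe_sphereProj (hne p) _).symm

lemma projectiveFlow_add
    (hsemi : ∀ s t : ℝ, 0 ≤ s → 0 ≤ t → ∀ x, Φ (s + t) x = Φ s (Φ t x))
    (hD : ∀ t : ℝ, 0 ≤ t → ∀ x, HasFDerivAt (Φ t) (D t x) x)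
    (hdet : ∀ t : ℝ, 0 ≤ t → ∀ x, LinearMap.det
      ((D t x) : EuclideanSpace ℝ (Fin n) →ₗ[ℝ] EuclideanSpace ℝ (Fin n)) = 1)
    (s t : ℝ) (hs : 0 ≤ s) (ht : 0 ≤ t)
    (p : EuclideanSpace ℝ (Fin n) × Metric.sphere (0 : EuclideanSpace ℝ (Fin n)) 1) :
    projectiveFlow Φ D (s + t) p = projectiveFlow Φ D s (projectiveFlow Φ D t p) := by
  have h1 : D t p.1 p.2.val ≠ 0 := apply_ne_zero_of_det_eq_one (hdet t ht _) (sphere_coe_ne_zero _)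
  have h2 : D s (Φ t p.1) (D t p.1 p.2.val) ≠ 0 := apply_ne_zero_of_det_eq_one (hdet s hs _) h1
  have hpos : ‖D t p.1 p.2.val‖ ≠ 0 := norm_ne_zero_iff.2 h1
  refine Prod.ext (hsemi s t hs ht p.1) (Subtype.ext ?_)
  simp only [projectiveFlow]
  rw [semiflow_fderiv_cocycle hsemi hD hs ht, coe_sphereProj h2, coe_sphereProj]
  · rw [coe_sphereProj h1, map_smul, norm_smul, norm_inv, norm_norm, mul_inv, inv_inv, smul_smul,
      mul_right_comm, mul_inv_cancel₀ hpos, one_mul]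
  · rw [coe_sphereProj h1, map_smul]
    exact smul_ne_zero (inv_ne_zero hpos) h2

lemma prod_le_of_fiber_le {E S : Type*} [NormedAddCommGroup E] [MeasurableSpace E]
    [OpensMeasurableSpace E] [MeasurableSpace S] {μ : Measure E} {σ : Measure S} [SFinite σ]
    {M : Set (E × S)} (hM : MeasurableSet M) {R : ℝ} (hMR : ∀ p ∈ M, ‖p.1‖ ≤ R) {K : ℝ≥0∞}
    (hK : ∀ x, (∃ v, (x, v) ∈ M) → σ (Prod.mk x ⁻¹' M) ≤ K) :
    (μ.prod σ) M ≤ μ (Metric.closedBall 0 R) * K := by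
  rw [Measure.prod_apply hM, mul_comm, ← lintegral_indicator_const Metric.isClosed_closedBall.measurableSet]
  refine lintegral_mono fun x => ?_
  by_cases hx : ∃ v, (x, v) ∈ M
  · obtain ⟨v, hv⟩ := hx
    rw [indicator_of_mem (by simpa using hMR _ hv)]
    exact hK x ⟨v, hv⟩
  · push Not at hx
    simp [eq_empty_of_forall_notMem (s := Prod.mk x ⁻¹' M) hx]

lemma exists_volume_ball_inv_lt [NeZero n] {K ε : ℝ≥0∞} (hK : K ≠ ∞) (hε : ε ≠ 0) :
    ∃ c : ℝ, 0 < c ∧ K * volume (Metric.ball (0 : EuclideanSpace ℝ (Fin n)) c⁻¹) < ε := by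
  have h1 : Tendsto (fun c : ℝ => ENNReal.ofReal ((c⁻¹) ^ n)) atTop (𝓝 0) := by
    have : Tendsto (fun c : ℝ => (c⁻¹) ^ n) atTop (𝓝 0) := by
      simpa [NeZero.ne n] using (tendsto_inv_atTop_zero (𝕜 := ℝ)).pow n
    simpa using ENNReal.tendsto_ofReal this
  have h2 : Tendsto (fun c : ℝ => K * (ENNReal.ofReal ((c⁻¹) ^ n) *
      volume (Metric.ball (0 : EuclideanSpace ℝ (Fin n)) 1))) atTop (𝓝 0) := by
    have := ENNReal.Tendsto.const_mul (a := K) (ENNReal.Tendsto.mul_const (b := volume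
      (Metric.ball (0 : EuclideanSpace ℝ (Fin n)) 1)) h1 (Or.inr measure_ball_lt_top.ne))
      (Or.inr hK)
    simpa using this
  obtain ⟨c, hc, hc0⟩ := ((h2.eventually_lt_const (pos_iff_ne_zero.2 hε)).and
    (eventually_gt_atTop 0)).exists
  refine ⟨c, hc0, ?_⟩
  rwa [Measure.addHaar_ball _ _ (inv_nonneg.2 hc0.le), finrank_euclideanSpace_fin]

end ProjectiveFlow

section Decay

variable {n : ℕ} [NeZero n] {Φ : ℝ → EuclideanSpace ℝ (Fin n) → EuclideanSpace ℝ (Fin n)}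
  {D : ℝ → EuclideanSpace ℝ (Fin n) → EuclideanSpace ℝ (Fin n) →L[ℝ] EuclideanSpace ℝ (Fin n)}
  {B : EuclideanSpace ℝ (Fin n) →ₗ[ℝ] EuclideanSpace ℝ (Fin n) →ₗ[ℝ] EuclideanSpace ℝ (Fin n)}

/-- A set on which `ν` has bounded density decorrelates from its preimages, because the
derivative of the flow grows linearly in the radial direction. -/
lemma measure_inter_preimage_projectiveFlow_lt
    (hderiv : ∀ (x : EuclideanSpace ℝ (Fin n)) (t : ℝ), 0 ≤ t →
      HasDerivWithinAt (fun s => Φ s x) (B (Φ t x) (Φ t x)) (Ici 0) t)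
    (huniq : ∀ (x : EuclideanSpace ℝ (Fin n)) (y : ℝ → EuclideanSpace ℝ (Fin n)), y 0 = x →
      (∀ t : ℝ, 0 ≤ t → HasDerivWithinAt y (B (y t) (y t)) (Ici 0) t) → ∀ t : ℝ, 0 ≤ t → y t = Φ t x)
    (h0 : ∀ x, Φ 0 x = x)
    (hC1 : ∀ t : ℝ, 0 ≤ t → ContDiff ℝ 1 (Φ t))
    (hD : ∀ t : ℝ, 0 ≤ t → ∀ x, HasFDerivAt (Φ t) (D t x) x)
    (hdet : ∀ t : ℝ, 0 ≤ t → ∀ x, LinearMap.det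
      ((D t x) : EuclideanSpace ℝ (Fin n) →ₗ[ℝ] EuclideanSpace ℝ (Fin n)) = 1)
    {ν : Measure (EuclideanSpace ℝ (Fin n) × Metric.sphere (0 : EuclideanSpace ℝ (Fin n)) 1)}
    (hinv : ∀ t : ℝ, 0 ≤ t → MeasurePreserving (projectiveFlow Φ D t) ν ν)
    {σ : Measure (Metric.sphere (0 : EuclideanSpace ℝ (Fin n)) 1)} [SFinite σ]
    {C : ℝ≥0∞} (hC : C ≠ ∞) (hσ : ∀ A, MeasurableSet A → σ A ≤ C * volume (sphereCone A))
    {G : Set (EuclideanSpace ℝ (Fin n) × Metric.sphere (0 : EuclideanSpace ℝ (Fin n)) 1)}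
    (hG : MeasurableSet G) {R δ : ℝ} (hR : 0 < R) (hδ : 0 < δ)
    (hGR : ∀ p ∈ G, ‖p.1‖ ≤ R ∧ δ ≤ ‖B p.1 p.1‖) {b : ℝ≥0∞} (hb : b ≠ ∞)
    (hνG : ∀ A, MeasurableSet A → ν (A ∩ G) ≤ b * (volume.prod σ) A)
    {ε : ℝ≥0∞} (hε : ε ≠ 0) :
    ∃ T : ℝ, ∀ t ≥ T, ν (G ∩ projectiveFlow Φ D t ⁻¹' G) < ε := by
  set V := volume (Metric.closedBall (0 : EuclideanSpace ℝ (Fin n)) R)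
  have hV : V ≠ ∞ := measure_closedBall_lt_top.ne
  set V₂ := volume (Metric.ball (0 : EuclideanSpace ℝ (Fin n)) 2)
  have hV₂ : V₂ ≠ ∞ := measure_ball_lt_top.ne
  have hε2 : ε / 2 ≠ 0 := (ENNReal.half_pos hε).ne'
  have hbVC : b * V * C ≠ ∞ := ENNReal.mul_ne_top (ENNReal.mul_ne_top hb hV) hC
  obtain ⟨c, hc, hcε⟩ := exists_volume_ball_inv_lt (n := n) hbVC hε2
  obtain ⟨N, hN⟩ := ENNReal.exists_nat_gt
    (ENNReal.div_ne_top (ENNReal.mul_ne_top hbVC hV₂) hε2)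
  have hN0 : (N : ℝ≥0∞) ≠ 0 := (pos_of_gt hN).ne'
  have hNpos : 0 < N := by
    rcases Nat.eq_zero_or_pos N with rfl | h
    · simp at hN0
    · exact h
  have hNε : b * V * C * (V₂ / N) < ε / 2 := by
    rw [← mul_div_assoc]
    refine ENNReal.div_lt_of_lt_mul' ?_
    exact (ENNReal.div_lt_iff (Or.inl hε2) (Or.inr (ENNReal.mul_ne_top hbVC hV₂))).1 hN
  refine ⟨(R + 2 * c * N * R) / δ + 1, fun t ht => ?_⟩
  have htδ : R + 2 * c * N * R < t * δ := by
    rw [← div_lt_iff₀ hδ]; linarith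
  have ht0 : 0 < t := by
    have : 0 ≤ (R + 2 * c * N * R) / δ := by positivity
    linarith
  have hDc := continuous_fderiv_flow (hC1 t ht0.le) (hD t ht0.le)
  let P := EuclideanSpace ℝ (Fin n) × Metric.sphere (0 : EuclideanSpace ℝ (Fin n)) 1
  have hfst : Measurable fun p : P => ‖p.1‖ := (continuous_fst.norm).measurable
  have hcoe : Continuous fun p : P => (p.2 : EuclideanSpace ℝ (Fin n)) :=
    continuous_subtype_val.comp continuous_snd
  let M₁ : Set P := {p | ‖p.1‖ ≤ R} ∩ {p | 2 * c * N * R < ‖D t p.1 p.1‖} ∩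
    {p | ‖D t p.1 p.2.val‖ ≤ c}
  have hM₁ : MeasurableSet M₁ := by
    refine ((measurableSet_le hfst measurable_const).inter
      (measurableSet_lt measurable_const ?_)).inter (measurableSet_le ?_ measurable_const)
    · exact ((hDc.comp continuous_fst).clm_apply continuous_fst).norm.measurable
    · exact ((hDc.comp continuous_fst).clm_apply hcoe).norm.measurable
  let M₂ : Set P := {p | ‖p.1‖ ≤ R} ∩ {p | ‖D t (-p.1) p.2.val‖ < c⁻¹}
  have hM₂ : MeasurableSet M₂ := by
    refine (measurableSet_le hfst measurable_const).inter (measurableSet_lt ?_ measurable_const)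
    exact ((hDc.comp continuous_fst.neg).clm_apply hcoe).norm.measurable
  have hprod_₁ : (volume.prod σ) M₁ ≤ V * (C * (V₂ / N)) := by
    refine prod_le_of_fiber_le hM₁ (fun p hp => hp.1.1) ?_
    rintro x ⟨v, ⟨hxR, hxD⟩, -⟩
    refine (measure_mono fun w hw => hw.2).trans ((hσ {θ | ‖D t x θ.1‖ ≤ c} ?_).trans ?_)
    · exact measurableSet_le (by fun_prop) measurable_const
    · gcongr
      rw [ENNReal.le_div_iff_mul_le (Or.inl hN0) (Or.inl (ENNReal.natCast_ne_top N)), mul_comm]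
      refine volume_sphereCone_le_le hNpos (u := R⁻¹ • x) ?_ ?_
      · rw [norm_smul, norm_inv, Real.norm_of_nonneg hR.le, ← div_eq_inv_mul]
        exact div_le_one_of_le₀ hxR hR.le
      · rw [map_smul, norm_smul, norm_inv, Real.norm_of_nonneg hR.le, ← div_eq_inv_mul,
          lt_div_iff₀ hR]
        exact hxD
  have hprod_₂ : (volume.prod σ) M₂ ≤
      V * (C * volume (Metric.ball (0 : EuclideanSpace ℝ (Fin n)) c⁻¹)) := by
    refine prod_le_of_fiber_le hM₂ (fun p hp => hp.1) ?_
    rintro x -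
    refine (measure_mono fun w hw => hw.2).trans ((hσ {θ | ‖D t (-x) θ.1‖ < c⁻¹} ?_).trans ?_)
    · exact measurableSet_lt (by fun_prop) measurable_const
    · exact mul_le_mul_right (volume_sphereCone_lt_le (hdet t ht0.le _) _) C
  have hsub : G ∩ projectiveFlow Φ D t ⁻¹' G ⊆
      (M₁ ∩ G) ∪ projectiveFlow Φ D t ⁻¹' (M₂ ∩ G) := by
    rintro ⟨x, v⟩ ⟨hp, hq⟩
    obtain ⟨hx, -⟩ := hGR _ hp
    obtain ⟨hy, hBy⟩ := hGR _ hq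
    simp only [projectiveFlow] at hx hy hBy
    by_cases hv : ‖D t x v.val‖ ≤ c
    · refine Or.inl ⟨⟨⟨hx, ?_⟩, hv⟩, hp⟩
      change 2 * c * N * R < ‖D t x x‖
      rw [quadratic_flow_fderiv_self hderiv huniq h0 hD ht0, add_comm]
      have h1 := norm_sub_le_norm_add (t • B (Φ t x) (Φ t x)) (Φ t x)
      rw [norm_smul, Real.norm_of_nonneg ht0.le] at h1
      nlinarith
    · refine Or.inr ⟨⟨hy, ?_⟩, hq⟩
      have hne := apply_ne_zero_of_det_eq_one (hdet t ht0.le x) (sphere_coe_ne_zero v)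
      change ‖D t (-Φ t x) (sphereProj (D t x v.val) v).val‖ < c⁻¹
      rw [coe_sphereProj hne, map_smul,
        quadratic_flow_fderiv_reverse hderiv huniq h0 hD ht0.le, norm_smul, norm_inv, norm_norm,
        norm_eq_of_mem_sphere, mul_one]
      exact inv_strictAnti₀ hc (not_le.1 hv)
  calc ν (G ∩ projectiveFlow Φ D t ⁻¹' G)
      ≤ ν (M₁ ∩ G) + ν (projectiveFlow Φ D t ⁻¹' (M₂ ∩ G)) :=
        (measure_mono hsub).trans (measure_union_le _ _)
    _ = ν (M₁ ∩ G) + ν (M₂ ∩ G) := by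
        rw [(hinv t ht0.le).measure_preimage (hM₂.inter hG).nullMeasurableSet]
    _ ≤ b * (V * (C * (V₂ / N))) +
        b * (V * (C * volume (Metric.ball (0 : EuclideanSpace ℝ (Fin n)) c⁻¹))) := by
        gcongr
        · exact (hνG _ hM₁).trans (by gcongr)
        · exact (hνG _ hM₂).trans (by gcongr)
    _ < ε / 2 + ε / 2 := by
        simp only [← mul_assoc] at hNε hcε ⊢
        exact ENNReal.add_lt_add hNε hcε
    _ = ε := ENNReal.add_halves ε

end Decay

end Helpers

/-- Rigidity for the projective flow of an Euler-like quadratic ODE `ẋ = B(x,x)` on `ℝⁿ`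
(`B` bilinear, energy-conserving, not identically zero): any Borel probability measure `ν`
on `ℝⁿ × S^{n-1}` invariant under the projective flow
`Φ̂(t)(x,v) = (Φ(t,x), DΦᵗ(x)v/‖DΦᵗ(x)v‖)` for all `t ≥ 0` and whose first marginal is
absolutely continuous with respect to Lebesgue measure is mutually singular with respect
to the product of Lebesgue measure and the surface measure on the sphere. -/
theorem projective_invariant_measure_singular (n : ℕ) (hn : 2 ≤ n)
    (B : EuclideanSpace ℝ (Fin n) →ₗ[ℝ] EuclideanSpace ℝ (Fin n) →ₗ[ℝ] EuclideanSpace ℝ (Fin n))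
    (hB0 : ∀ x : EuclideanSpace ℝ (Fin n), ⟪x, B x x⟫ = 0)
    (hBne : ∃ x : EuclideanSpace ℝ (Fin n), B x x ≠ 0)
    (Φ : ℝ → EuclideanSpace ℝ (Fin n) → EuclideanSpace ℝ (Fin n))
    (h0 : ∀ x, Φ 0 x = x)
    (hsemi : ∀ s t : ℝ, 0 ≤ s → 0 ≤ t → ∀ x, Φ (s + t) x = Φ s (Φ t x))
    (hderiv : ∀ (x : EuclideanSpace ℝ (Fin n)) (t : ℝ), 0 ≤ t →
      HasDerivWithinAt (fun s => Φ s x) (B (Φ t x) (Φ t x)) (Set.Ici 0) t)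
    (huniq : ∀ (x : EuclideanSpace ℝ (Fin n)) (y : ℝ → EuclideanSpace ℝ (Fin n)),
      y 0 = x →
      (∀ t : ℝ, 0 ≤ t → HasDerivWithinAt y (B (y t) (y t)) (Set.Ici 0) t) →
      ∀ t : ℝ, 0 ≤ t → y t = Φ t x)
    (D : ℝ → EuclideanSpace ℝ (Fin n) → (EuclideanSpace ℝ (Fin n) →L[ℝ] EuclideanSpace ℝ (Fin n)))
    (hC1 : ∀ t : ℝ, 0 ≤ t → ContDiff ℝ 1 (Φ t))
    (hD : ∀ (t : ℝ), 0 ≤ t → ∀ x, HasFDerivAt (Φ t) (D t x) x)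
    (hdet : ∀ (t : ℝ), 0 ≤ t → ∀ x, LinearMap.det ((D t x) : EuclideanSpace ℝ (Fin n) →ₗ[ℝ] EuclideanSpace ℝ (Fin n)) = 1)
    (ν : Measure (EuclideanSpace ℝ (Fin n) × Metric.sphere (0 : EuclideanSpace ℝ (Fin n)) 1))
    [IsProbabilityMeasure ν]
    (hinv : ∀ t : ℝ, 0 ≤ t →
      ν.map (fun p => (Φ t p.1, sphereProj (D t p.1 p.2.val) p.2)) = ν)
    (hac : ν.map Prod.fst ≪ (volume : Measure (EuclideanSpace ℝ (Fin n)))) :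
    ν.MutuallySingular
      ((volume : Measure (EuclideanSpace ℝ (Fin n))).prod
        (μH[(n : ℝ) - 1] : Measure (Metric.sphere (0 : EuclideanSpace ℝ (Fin n)) 1))) := by
  obtain ⟨k, rfl⟩ : ∃ k, n = k + 1 := ⟨n - 1, by omega⟩
  obtain ⟨C, hC, hσ⟩ := exists_hausdorffMeasure_sphere_le k
  have hdim : (((k + 1 : ℕ) : ℝ) - 1) = k := by push_cast; ring
  rw [hdim]
  have : IsFiniteMeasure
      (μH[(k : ℝ)] : Measure (Metric.sphere (0 : EuclideanSpace ℝ (Fin (k + 1))) 1)) := by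
    refine ⟨(hσ Set.univ MeasurableSet.univ).trans_lt (ENNReal.mul_lt_top hC.lt_top ?_)⟩
    refine (measure_mono ?_).trans_lt
      (measure_ball_lt_top (x := (0 : EuclideanSpace ℝ (Fin (k + 1)))) (r := 1))
    rintro _ ⟨a, ha, _, ⟨θ, -, rfl⟩, rfl⟩
    simpa [norm_smul, abs_of_pos ha.1] using ha.2
  have hmp : ∀ t : ℝ, 0 ≤ t → MeasurePreserving (projectiveFlow Φ D t) ν ν := fun t ht =>
    ⟨measurable_projectiveFlow (hC1 t ht) (hD t ht) (hdet t ht), hinv t ht⟩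
  by_contra hcon
  have hBc : Continuous fun x : EuclideanSpace ℝ (Fin (k + 1)) => ‖B x x‖ :=
    (B.toContinuousBilinearMap.continuous₂.comp (continuous_id.prodMk continuous_id)).norm
  let H : ℕ → Set (EuclideanSpace ℝ (Fin (k + 1)) ×
      Metric.sphere (0 : EuclideanSpace ℝ (Fin (k + 1))) 1) :=
    fun m => {p | ‖p.1‖ ≤ (m : ℝ) + 1} ∩ {p | ((m : ℝ) + 1)⁻¹ ≤ ‖B p.1 p.1‖}
  have hHm : ∀ m, MeasurableSet (H m) := fun m =>
    (measurableSet_le continuous_fst.norm.measurable measurable_const).inter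
      (measurableSet_le measurable_const (hBc.comp continuous_fst).measurable)
  have hHmono : Monotone H := by
    intro m m' hmm' p hp
    have h : (m : ℝ) ≤ m' := by exact_mod_cast hmm'
    have hp1 : ‖p.1‖ ≤ (m : ℝ) + 1 := hp.1
    have hp2 : ((m : ℝ) + 1)⁻¹ ≤ ‖B p.1 p.1‖ := hp.2
    exact ⟨hp1.trans (by linarith), le_trans (by gcongr) hp2⟩
  have hH : ∀ᵐ p ∂((volume : Measure (EuclideanSpace ℝ (Fin (k + 1)))).prod
      (μH[(k : ℝ)] : Measure (Metric.sphere (0 : EuclideanSpace ℝ (Fin (k + 1))) 1))),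
      ∃ m, p ∈ H m := by
    filter_upwards [Measure.quasiMeasurePreserving_fst.ae (ae_quadratic_ne_zero volume B hBne)]
      with p hp
    obtain ⟨m, hm⟩ := exists_nat_ge (max ‖p.1‖ ‖B p.1 p.1‖⁻¹)
    refine ⟨m, ?_, ?_⟩
    · exact (le_max_left _ _).trans (hm.trans (by linarith))
    · exact inv_le_of_inv_le₀ (norm_pos_iff.2 hp)
        ((le_max_right _ _).trans (hm.trans (by linarith)))
  obtain ⟨m, G, hGH, hGm, hG0, hνG⟩ :=
    exists_dominated_set_of_not_mutuallySingular hcon hHm hHmono hH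
  obtain ⟨ε, hε, hrec⟩ := exists_le_measure_inter_preimage hmp
    (projectiveFlow_add hsemi hD hdet) hGm hG0
  obtain ⟨T, hT⟩ := measure_inter_preimage_projectiveFlow_lt hderiv huniq h0 hC1 hD hdet hmp hC hσ
    hGm (R := (m : ℝ) + 1) (δ := ((m : ℝ) + 1)⁻¹) (by positivity) (by positivity)
    (fun p hp => hGH hp) (ENNReal.natCast_ne_top m) hνG hε.ne'
  obtain ⟨t, htT, ht⟩ := hrec T
  exact (hT t htT).not_ge ht
end

section
/- Let d ≥ 1, σ ∈ (0,1). Fix φ : ℝ^d → ℝ smooth, nonnegative, supported in the unit ball, with ∫ φ = 1, and for τ ∈ (0,1) set φ_τ(x) := τ^{−d} φ(x/τ). Let a : ℝ^d → ℝ^d be continuously differentiable with ‖a‖_∞ and ‖Da‖_∞ finite, and denote by Y the first-order operator (Yw)(x) = a(x)·∇w(x). Then there exists C > 0 (depending only on d, σ, φ, ‖a‖_∞, ‖Da‖_∞) such that for every τ ∈ (0,1) and every smooth compactly supported w : ℝ^d → ℝ, the commutator of Y with mollification satisfies ∫_{ℝ^d} | a(x)·∇(φ_τ * w)(x) − (φ_τ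 * (a·∇w))(x) | dx ≤ C τ^σ ( ‖w‖_{L¹} + [w]_σ ), where [w]_σ := sup_{h ∈ ℝ^d, 0 < |h| ≤ 1} |h|^{−σ} ∫ |w(x+h) − w(x)| dx. -/
open MeasureTheory ENNReal

/-- The `L¹` Hölder–Besov seminorm of order `σ`:
`[w]_σ = sup_{0 < |h| ≤ 1} |h|^{-σ} ∫ |w(x+h) − w(x)| dx`. -/
noncomputable def besovSeminorm (d : ℕ) (σ : ℝ) (w : (Fin d → ℝ) → ℝ) : ℝ≥0∞ :=
  ⨆ h ∈ {h : Fin d → ℝ | 0 < ‖h‖ ∧ ‖h‖ ≤ 1},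
    ENNReal.ofReal (‖h‖ ^ (-σ)) * ∫⁻ x, (‖w (x + h) - w x‖₊ : ℝ≥0∞)

/-- The mollifier at scale `τ`: `φ_τ(x) = τ^{-d} φ(x/τ)`. -/
noncomputable def mollifier (d : ℕ) (φ : (Fin d → ℝ) → ℝ) (τ : ℝ) (x : Fin d → ℝ) : ℝ :=
  (τ ^ d)⁻¹ * φ (τ⁻¹ • x)

/-- Convolution: `(f * g)(x) = ∫ f(x−y) g(y) dy`. -/
noncomputable def conv (d : ℕ) (f g : (Fin d → ℝ) → ℝ) (x : Fin d → ℝ) : ℝ :=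
  ∫ y, f (x - y) * g y

/-- The divergence of a vector field on `ℝ^d`. -/
noncomputable def divergence {d : ℕ} (F : (Fin d → ℝ) → (Fin d → ℝ)) (y : Fin d → ℝ) : ℝ :=
  ∑ i, fderiv ℝ F y (Pi.single i 1) i

theorem sum_apply_single_mul {d : ℕ} (L : (Fin d → ℝ) →L[ℝ] ℝ) (v : Fin d → ℝ) :
    ∑ i, L (Pi.single i 1) * v i = L v := by
  have h := LinearMap.pi_apply_eq_sum_univ (L : (Fin d → ℝ) →ₗ[ℝ] ℝ) v
  simp only [ContinuousLinearMap.coe_coe, smul_eq_mul] at h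
  rw [h]
  refine Finset.sum_congr rfl fun i _ => ?_
  rw [mul_comm]
  congr 2
  ext j
  simp [Pi.single_apply, eq_comm]

theorem abs_divergence_le {d : ℕ} {F : (Fin d → ℝ) → (Fin d → ℝ)} {y : Fin d → ℝ} {K : ℝ}
    (hK : ‖fderiv ℝ F y‖ ≤ K) : |divergence F y| ≤ d * K := by
  refine (Finset.abs_sum_le_sum_abs _ _).trans ?_
  have h : ∀ i ∈ (Finset.univ : Finset (Fin d)),
      |fderiv ℝ F y (Pi.single i 1) i| ≤ K := by
    intro i _
    calc |fderiv ℝ F y (Pi.single i 1) i| ≤ ‖fderiv ℝ F y (Pi.single i 1)‖ :=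
          norm_le_pi_norm (fderiv ℝ F y (Pi.single i 1)) i
      _ ≤ ‖fderiv ℝ F y‖ * ‖(Pi.single i 1 : Fin d → ℝ)‖ := ContinuousLinearMap.le_opNorm _ _
      _ ≤ K := by simpa [Pi.norm_single] using hK
  simpa using Finset.sum_le_sum h

theorem integral_divergence_eq_zero {d : ℕ} {F : (Fin d → ℝ) → (Fin d → ℝ)}
    (hF : ContDiff ℝ 1 F) (hc : HasCompactSupport F) : ∫ y, divergence F y = 0 := by
  have hderiv : ∀ i y, fderiv ℝ (fun y => F y i) y (Pi.single i 1)
      = fderiv ℝ F y (Pi.single i 1) i := by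
    intro i y
    rw [fderiv_apply (hF.differentiable one_ne_zero y)]
    rfl
  have hcont : ∀ i, Continuous fun y => fderiv ℝ F y (Pi.single i 1) i := fun i =>
    (continuous_apply i).comp ((hF.continuous_fderiv one_ne_zero).clm_apply continuous_const)
  have hint : ∀ i, Integrable fun y => fderiv ℝ F y (Pi.single i 1) i := fun i =>
    (hcont i).integrable_of_hasCompactSupport <|
      (hc.fderiv ℝ).comp_left (g := fun L : (Fin d → ℝ) →L[ℝ] (Fin d → ℝ) => L (Pi.single i 1) i)
        (by simp)
  unfold divergence
  rw [integral_finsetSum _ fun i _ => hint i]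
  refine Finset.sum_eq_zero fun i _ => ?_
  have hFi : Integrable fun y => F y i :=
    ((continuous_apply i).comp hF.continuous).integrable_of_hasCompactSupport <|
      hc.comp_left (g := fun v : Fin d → ℝ => v i) (by simp)
  have h := integral_mul_fderiv_eq_neg_fderiv_mul_of_integrable (μ := volume)
    (f := fun y => F y i) (g := fun _ => (1 : ℝ)) (v := Pi.single i 1)
    (by simpa [hderiv] using hint i) (by simp) (by simpa using hFi)
    (fun y _ => (differentiableAt_pi.1 (hF.differentiable one_ne_zero y)) i) (by simp)
  simpa [hderiv] using h

theorem divergence_smul {d : ℕ} {f : (Fin d → ℝ) → ℝ} {F : (Fin d → ℝ) → (Fin d → ℝ)}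
    {y : Fin d → ℝ} (hf : DifferentiableAt ℝ f y) (hF : DifferentiableAt ℝ F y) :
    divergence (fun z => f z • F z) y = fderiv ℝ f y (F y) + f y * divergence F y := by
  unfold divergence
  rw [fderiv_fun_smul hf hF, ← sum_apply_single_mul (fderiv ℝ f y), Finset.mul_sum,
    ← Finset.sum_add_distrib]
  refine Finset.sum_congr rfl fun i _ => ?_
  simp [add_comm]

theorem fderiv_conv_apply {d : ℕ} {f g : (Fin d → ℝ) → ℝ} (hf : ContDiff ℝ 1 f)
    (hfc : HasCompactSupport f) (hg : Continuous g) (x v : Fin d → ℝ) :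
    fderiv ℝ (conv d f g) x v = ∫ y, fderiv ℝ f (x - y) v * g y := by
  have hconv : conv d f g = convolution g f (ContinuousLinearMap.mul ℝ ℝ) volume := by
    ext x
    simp [conv, convolution_def, mul_comm]
  rw [hconv, (hfc.hasFDerivAt_convolution_right _ hg.locallyIntegrable hf x).fderiv,
    convolution_precompR_apply _ hg.locallyIntegrable (hfc.fderiv ℝ)
      (hf.continuous_fderiv one_ne_zero)]
  simp [convolution_def, mul_comm]

/-- The commutator of `a·∇` with convolution, after integration by parts. -/
theorem fderiv_conv_sub_conv_fderiv {d : ℕ} {f w : (Fin d → ℝ) → ℝ}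
    {a : (Fin d → ℝ) → (Fin d → ℝ)} (hf : ContDiff ℝ 1 f) (hfc : HasCompactSupport f)
    (hw : ContDiff ℝ 1 w) (ha : ContDiff ℝ 1 a) (x : Fin d → ℝ) :
    fderiv ℝ (conv d f w) x (a x) - conv d f (fun y => fderiv ℝ w y (a y)) x
      = ∫ y, (fderiv ℝ f (x - y) (a x - a y) + f (x - y) * divergence a y) * (w y - w x) := by
  have hfx : ContDiff ℝ 1 fun y => f (x - y) := hf.comp (contDiff_const.sub contDiff_id)
  have hfxc : HasCompactSupport fun y => f (x - y) :=
    hfc.comp_homeomorph (Homeomorph.subLeft x)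
  have hV : ContDiff ℝ 1 fun y => (w y - w x) • a y + w x • a x :=
    ((hw.sub contDiff_const).smul ha).add contDiff_const
  have hF : ContDiff ℝ 1 fun y => f (x - y) • ((w y - w x) • a y + w x • a x) := hfx.smul hV
  have hFc : HasCompactSupport fun y => f (x - y) • ((w y - w x) • a y + w x • a x) :=
    hfxc.smul_right
  have hfderiv : ∀ y v, fderiv ℝ (fun y => f (x - y)) y v = - fderiv ℝ f (x - y) v := by
    intro y v
    have h : fderiv ℝ (fun y => f (x - y)) y = _ :=
      ((hf.differentiable one_ne_zero (x - y)).hasFDerivAt.comp y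
        ((hasFDerivAt_id y).const_sub x)).fderiv
    simpa using congrArg (fun L : (Fin d → ℝ) →L[ℝ] ℝ => L v) h
  have hdivV : ∀ y, divergence (fun y => (w y - w x) • a y + w x • a x) y
      = fderiv ℝ w y (a y) + (w y - w x) * divergence a y := by
    intro y
    have h1 : divergence (fun y => (w y - w x) • a y + w x • a x) y
        = divergence (fun y => (w y - w x) • a y) y := by
      simp only [divergence, fderiv_add_const]
    rw [h1, divergence_smul ((hw.differentiable one_ne_zero y).sub_const _)
      (ha.differentiable one_ne_zero y), fderiv_sub_const]
  have hdiv : ∀ y, divergence (fun y => f (x - y) • ((w y - w x) • a y + w x • a x)) y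
      = -fderiv ℝ f (x - y) ((w y - w x) • a y + w x • a x)
        + f (x - y) * (fderiv ℝ w y (a y) + (w y - w x) * divergence a y) := by
    intro y
    rw [divergence_smul (hfx.differentiable one_ne_zero y) (hV.differentiable one_ne_zero y),
      hdivV, hfderiv]
  have hDf : Continuous fun y => fderiv ℝ f (x - y) :=
    (hf.continuous_fderiv one_ne_zero).comp (continuous_const.sub continuous_id)
  have hDfc : HasCompactSupport fun y => fderiv ℝ f (x - y) :=
    (hfc.fderiv ℝ).comp_homeomorph (Homeomorph.subLeft x)
  have hI1 : Integrable fun y => fderiv ℝ f (x - y) (a x) * w y := by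
    refine ((hDf.clm_apply continuous_const).mul hw.continuous).integrable_of_hasCompactSupport ?_
    exact (hDfc.comp_left (g := fun L : (Fin d → ℝ) →L[ℝ] ℝ => L (a x)) (by simp)).mul_right
  have hI2 : Integrable fun y => f (x - y) * fderiv ℝ w y (a y) :=
    (hfx.continuous.mul ((hw.continuous_fderiv one_ne_zero).clm_apply
      ha.continuous)).integrable_of_hasCompactSupport hfxc.mul_right
  have hdivc : Continuous
      (divergence fun y => f (x - y) • ((w y - w x) • a y + w x • a x)) :=
    continuous_finsetSum _ fun i _ => (continuous_apply i).comp
      ((hF.continuous_fderiv one_ne_zero).clm_apply continuous_const)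
  have hI3 : Integrable
      (divergence fun y => f (x - y) • ((w y - w x) • a y + w x • a x)) := by
    refine hdivc.integrable_of_hasCompactSupport ?_
    exact (hFc.fderiv ℝ).comp_left
      (g := fun L : (Fin d → ℝ) →L[ℝ] (Fin d → ℝ) => ∑ i, L (Pi.single i 1) i) (by simp)
  rw [fderiv_conv_apply hf hfc hw.continuous, conv, ← integral_sub hI1 hI2,
    ← add_zero (∫ y, _), ← integral_divergence_eq_zero hF hFc,
    ← integral_add (by exact hI1.sub hI2) hI3]
  refine integral_congr_ae (Filter.Eventually.of_forall fun y => ?_)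
  simp only [hdiv, map_add, map_sub, map_smul, smul_eq_mul]
  ring

/-- Translation increments of `w` in `L¹` are controlled by the Besov seminorm. -/
theorem lintegral_translate_sub_le {d : ℕ} {σ : ℝ} (w : (Fin d → ℝ) → ℝ) {h : Fin d → ℝ}
    (h0 : 0 < ‖h‖) (h1 : ‖h‖ ≤ 1) :
    ∫⁻ x, ‖w (x + h) - w x‖ₑ ≤ ENNReal.ofReal (‖h‖ ^ σ) * besovSeminorm d σ w := by
  have hle : ENNReal.ofReal (‖h‖ ^ (-σ)) * ∫⁻ x, ‖w (x + h) - w x‖ₑ ≤ besovSeminorm d σ w :=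
    le_iSup₂_of_le (f := fun (h : Fin d → ℝ) (_ : h ∈ {h : Fin d → ℝ | 0 < ‖h‖ ∧ ‖h‖ ≤ 1}) =>
      ENNReal.ofReal (‖h‖ ^ (-σ)) * ∫⁻ x, (‖w (x + h) - w x‖₊ : ℝ≥0∞)) h ⟨h0, h1⟩ le_rfl
  calc ∫⁻ x, ‖w (x + h) - w x‖ₑ
      = ENNReal.ofReal (‖h‖ ^ σ) *
          (ENNReal.ofReal (‖h‖ ^ (-σ)) * ∫⁻ x, ‖w (x + h) - w x‖ₑ) := by
        rw [← mul_assoc, ← ENNReal.ofReal_mul (by positivity), ← Real.rpow_add h0]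
        simp
    _ ≤ _ := by gcongr

/-- A kernel bounded by `c` and supported in a ball of radius `τ` maps increments of `w` to a
function whose `L¹` norm is of size `c τ^d τ^σ [w]_σ`. -/
theorem lintegral_kernel_le {d : ℕ} {σ τ c : ℝ} (hσ : 0 < σ) (hτ0 : 0 < τ) (hτ1 : τ ≤ 1)
    {w : (Fin d → ℝ) → ℝ} (hw : Continuous w) {H : (Fin d → ℝ) → (Fin d → ℝ) → ℝ}
    (hc : 0 ≤ c) (hH : ∀ x y, ‖x - y‖ ≤ τ → |H x y| ≤ c * |w y - w x|)
    (hH0 : ∀ x y, τ < ‖x - y‖ → H x y = 0) :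
    ∫⁻ x, ‖∫ y, H x y‖ₑ
      ≤ ENNReal.ofReal (c * (2 * τ) ^ d * τ ^ σ) * besovSeminorm d σ w := by
  have hpt : ∀ x, ‖∫ y, H x y‖ₑ
      ≤ ∫⁻ z in Metric.closedBall 0 τ, ENNReal.ofReal c * ‖w (x - z) - w x‖ₑ := by
    intro x
    refine (enorm_integral_le_lintegral_enorm _).trans ?_
    rw [← lintegral_indicator Metric.isClosed_closedBall.measurableSet,
      ← lintegral_sub_left_eq_self (fun y => ‖H x y‖ₑ) x]
    refine lintegral_mono fun z => ?_
    by_cases hz : ‖z‖ ≤ τ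
    · rw [Set.indicator_of_mem (by simpa using hz), ← enorm_norm (w _ - _), ← enorm_norm (H _ _),
        Real.enorm_of_nonneg (norm_nonneg _), Real.enorm_of_nonneg (norm_nonneg _),
        ← ENNReal.ofReal_mul hc]
      exact ENNReal.ofReal_le_ofReal (hH x (x - z) (by simpa using hz))
    · rw [hH0 x (x - z) (by simpa using hz)]
      simp
  have hmeas : Measurable fun p : (Fin d → ℝ) × (Fin d → ℝ) =>
      ENNReal.ofReal c * ‖w (p.1 - p.2) - w p.1‖ₑ := by
    have : Continuous fun p : (Fin d → ℝ) × (Fin d → ℝ) => w (p.1 - p.2) - w p.1 := by fun_prop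
    exact this.measurable.enorm.const_mul _
  have hinner : ∀ z ∈ Metric.closedBall (0 : Fin d → ℝ) τ,
      ∫⁻ x, ENNReal.ofReal c * ‖w (x - z) - w x‖ₑ
        ≤ ENNReal.ofReal (c * τ ^ σ) * besovSeminorm d σ w := by
    intro z hz
    have hz' : ‖z‖ ≤ τ := by simpa using hz
    rw [lintegral_const_mul' _ _ ENNReal.ofReal_ne_top]
    rcases eq_or_ne z 0 with rfl | hz0
    · simp
    have h := lintegral_translate_sub_le (σ := σ) w (h := -z) (by simpa using hz0)
      (by simpa using hz'.trans hτ1)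
    simp only [← sub_eq_add_neg, norm_neg] at h
    rw [ENNReal.ofReal_mul hc, mul_assoc]
    gcongr
    refine h.trans ?_
    gcongr
  calc ∫⁻ x, ‖∫ y, H x y‖ₑ
      ≤ ∫⁻ x, ∫⁻ z in Metric.closedBall 0 τ, ENNReal.ofReal c * ‖w (x - z) - w x‖ₑ :=
        lintegral_mono hpt
    _ = ∫⁻ z in Metric.closedBall 0 τ, ∫⁻ x, ENNReal.ofReal c * ‖w (x - z) - w x‖ₑ :=
        lintegral_lintegral_swap hmeas.aemeasurable
    _ ≤ ∫⁻ _ in Metric.closedBall (0 : Fin d → ℝ) τ,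
          ENNReal.ofReal (c * τ ^ σ) * besovSeminorm d σ w :=
        setLIntegral_mono measurable_const hinner
    _ = ENNReal.ofReal (c * (2 * τ) ^ d * τ ^ σ) * besovSeminorm d σ w := by
        rw [setLIntegral_const, Real.volume_pi_closedBall _ hτ0.le, Fintype.card_fin,
          mul_right_comm, ← ENNReal.ofReal_mul (by positivity)]
        ring_nf

theorem contDiff_mollifier {d : ℕ} {φ : (Fin d → ℝ) → ℝ} {n : WithTop ℕ∞} (hφ : ContDiff ℝ n φ)
    (τ : ℝ) : ContDiff ℝ n (mollifier d φ τ) :=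
  contDiff_const.mul (hφ.comp (contDiff_const_smul _))

theorem support_mollifier_subset {d : ℕ} {φ : (Fin d → ℝ) → ℝ}
    (hφ : Function.support φ ⊆ Metric.closedBall 0 1) {τ : ℝ} (hτ : 0 < τ) :
    Function.support (mollifier d φ τ) ⊆ Metric.closedBall 0 τ := by
  intro x hx
  have h : τ⁻¹ • x ∈ Metric.closedBall (0 : Fin d → ℝ) 1 := hφ (right_ne_zero_of_mul hx)
  rw [mem_closedBall_zero_iff, norm_smul, Real.norm_of_nonneg (by positivity),
    inv_mul_le_one₀ hτ] at h
  simpa using h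

theorem norm_fderiv_mollifier_le {d : ℕ} {φ : (Fin d → ℝ) → ℝ} {M τ : ℝ}
    (hM : ∀ x, ‖fderiv ℝ φ x‖ ≤ M) (hφ : ContDiff ℝ 1 φ) (hτ : 0 < τ) (x : Fin d → ℝ) :
    ‖fderiv ℝ (mollifier d φ τ) x‖ ≤ (τ ^ d)⁻¹ * (τ⁻¹ * M) := by
  have hd : DifferentiableAt ℝ (fun z => φ (τ⁻¹ • z)) x :=
    (hφ.comp (contDiff_const_smul _)).differentiable one_ne_zero x
  have h : fderiv ℝ (mollifier d φ τ) x = (τ ^ d)⁻¹ • τ⁻¹ • fderiv ℝ φ (τ⁻¹ • x) := by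
    rw [← fderiv_comp_smul, ← fderiv_const_smul hd]
    rfl
  rw [h, norm_smul, norm_smul, Real.norm_of_nonneg (by positivity),
    Real.norm_of_nonneg (by positivity)]
  gcongr
  exact hM _

/-- Commutator estimate for mollification along a `C¹` vector field `a`: with
`φ_τ` a standard mollifier, for all `0 < τ < 1` and all smooth compactly supported `w`,
`∫ |a·∇(φ_τ * w) − φ_τ * (a·∇w)| dx ≤ C τ^σ (‖w‖_{L¹} + [w]_σ)`, where `C` depends only
on `d`, `σ`, `φ` and a bound `K` on `‖a‖_∞` and `‖Da‖_∞`. -/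
theorem mollifier_commutator_estimate (d : ℕ) (hd : 1 ≤ d) (σ : ℝ) (hσ0 : 0 < σ) (hσ1 : σ < 1)
    (φ : (Fin d → ℝ) → ℝ) (hφsm : ContDiff ℝ (⊤ : ℕ∞) φ) (hφnn : ∀ x, 0 ≤ φ x)
    (hφsupp : Function.support φ ⊆ Metric.closedBall 0 1) (hφint : ∫ x, φ x = 1)
    (K : ℝ) :
    ∃ C : ℝ, 0 < C ∧ ∀ a : (Fin d → ℝ) → (Fin d → ℝ), ContDiff ℝ 1 a →
      (∀ x, ‖a x‖ ≤ K) → (∀ x, ‖fderiv ℝ a x‖ ≤ K) →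
      ∀ τ : ℝ, 0 < τ → τ < 1 →
      ∀ w : (Fin d → ℝ) → ℝ, ContDiff ℝ (⊤ : ℕ∞) w → HasCompactSupport w →
      (∫⁻ x, (‖fderiv ℝ (conv d (mollifier d φ τ) w) x (a x)
          - conv d (mollifier d φ τ) (fun y => fderiv ℝ w y (a y)) x‖₊ : ℝ≥0∞)) ≤
        ENNReal.ofReal (C * τ ^ σ) *
          ((∫⁻ x, (‖w x‖₊ : ℝ≥0∞)) + besovSeminorm d σ w) := by
  have hφ1 : ContDiff ℝ 1 φ := hφsm.of_le (by exact_mod_cast le_top)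
  have hφc : HasCompactSupport φ :=
    HasCompactSupport.of_support_subset_isCompact (isCompact_closedBall 0 1) hφsupp
  obtain ⟨M₀, hM₀⟩ := hφc.exists_bound_of_continuous hφ1.continuous
  obtain ⟨M₁, hM₁⟩ :=
    (hφc.fderiv ℝ).exists_bound_of_continuous (hφ1.continuous_fderiv one_ne_zero)
  have hM₀0 : 0 ≤ M₀ := (norm_nonneg _).trans (hM₀ 0)
  have hM₁0 : 0 ≤ M₁ := (norm_nonneg _).trans (hM₁ 0)
  refine ⟨(M₁ * |K| + M₀ * (d * |K|)) * 2 ^ d + 1, by positivity, ?_⟩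
  intro a ha _ hDa τ hτ0 hτ1 w hw _
  have hK : 0 ≤ K := (norm_nonneg _).trans (hDa 0)
  rw [abs_of_nonneg hK]
  have hψ : ContDiff ℝ 1 (mollifier d φ τ) := contDiff_mollifier hφ1 τ
  have hψsupp := support_mollifier_subset hφsupp hτ0
  have hψc : HasCompactSupport (mollifier d φ τ) :=
    HasCompactSupport.of_support_subset_isCompact (isCompact_closedBall 0 τ) hψsupp
  have hw1 : ContDiff ℝ 1 w := hw.of_le (by exact_mod_cast le_top)
  have hψ0 : ∀ z, τ < ‖z‖ → mollifier d φ τ z = 0 ∧ fderiv ℝ (mollifier d φ τ) z = 0 := by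
    intro z hz
    have hz' : z ∉ tsupport (mollifier d φ τ) := fun h => by
      have := closure_minimal hψsupp Metric.isClosed_closedBall h
      rw [mem_closedBall_zero_iff] at this
      linarith
    exact ⟨image_eq_zero_of_notMem_tsupport hz', fderiv_of_notMem_tsupport ℝ hz'⟩
  have hkernel : ∀ x y, ‖x - y‖ ≤ τ →
      |(fderiv ℝ (mollifier d φ τ) (x - y) (a x - a y)
          + mollifier d φ τ (x - y) * divergence a y) * (w y - w x)|
        ≤ ((τ ^ d)⁻¹ * (M₁ * K + M₀ * (d * K))) * |w y - w x| := by
    intro x y hxy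
    rw [abs_mul]
    gcongr
    have hLip : ‖a x - a y‖ ≤ K * τ :=
      (convex_univ.norm_image_sub_le_of_norm_fderiv_le (𝕜 := ℝ)
        (fun z _ => ha.differentiable one_ne_zero z) (fun z _ => hDa z)
        (Set.mem_univ y) (Set.mem_univ x)).trans (by gcongr)
    have h1 : |fderiv ℝ (mollifier d φ τ) (x - y) (a x - a y)| ≤ (τ ^ d)⁻¹ * (M₁ * K) :=
      calc |fderiv ℝ (mollifier d φ τ) (x - y) (a x - a y)|
          ≤ ‖fderiv ℝ (mollifier d φ τ) (x - y)‖ * ‖a x - a y‖ :=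
            (fderiv ℝ (mollifier d φ τ) (x - y)).le_opNorm _
        _ ≤ ((τ ^ d)⁻¹ * (τ⁻¹ * M₁)) * (K * τ) := by
            gcongr
            exact norm_fderiv_mollifier_le hM₁ hφ1 hτ0 _
        _ = (τ ^ d)⁻¹ * (M₁ * K) := by field_simp
    have h2 : |mollifier d φ τ (x - y) * divergence a y| ≤ (τ ^ d)⁻¹ * (M₀ * (d * K)) := by
      rw [abs_mul, mollifier, abs_mul, abs_of_nonneg (by positivity : 0 ≤ (τ ^ d)⁻¹), mul_assoc]
      gcongr
      · exact hM₀ _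
      · exact abs_divergence_le (hDa y)
    calc _ ≤ _ := abs_add_le _ _
      _ ≤ (τ ^ d)⁻¹ * (M₁ * K) + (τ ^ d)⁻¹ * (M₀ * (d * K)) := add_le_add h1 h2
      _ = _ := by ring
  have hmain := lintegral_kernel_le hσ0 hτ0 hτ1.le hw1.continuous (by positivity) hkernel
    (fun x y hxy => by simp [hψ0 _ hxy])
  simp only [← fderiv_conv_sub_conv_fderiv hψ hψc hw1 ha] at hmain
  refine hmain.trans ?_
  gcongr
  · calc (τ ^ d)⁻¹ * (M₁ * K + M₀ * (d * K)) * (2 * τ) ^ d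
        = (M₁ * K + M₀ * (d * K)) * 2 ^ d := by
          rw [mul_pow]
          field_simp
      _ ≤ _ := by linarith
  · exact le_add_self
end

section
/- Let d, r ≥ 1. Let X₀ : ℝ^d → ℝ^d be continuously differentiable and let a_1, …, a_r : ℝ^d → ℝ^d be continuous vector fields. For h ∈ L¹(ℝ^d) define the negative-regularity functional 𝔇(h) := sup { | ∫_{ℝ^d} h(x) · (X₀(x)·∇v(x)) dx | : v smooth compactly supported with ‖v‖_{L^∞} + Σ_{j=1}^r ‖a_j·∇v‖_{L^∞} ≤ 1 }. Then for every open bounded set U ⊆ ℝ^d and every smooth χ : ℝ^d → ℝ compactly supported in U, there exists C > 0 (depending on χ, on the C¹ norm of X₀ on the closure of U, and on the sup norms of the a_j on the support of χ) such that for all h ∈ L¹(ℝ^d): 𝔇(χ·h) ≤ C ( ‖h‖_{L¹} + 𝔇(h) ). -/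
open MeasureTheory ENNReal

/-- The negative-regularity (dual `W^{-1,∞}`-type) functional
`𝔇(h) = sup { |∫ h (X₀·∇v)| : v smooth compactly supported,
‖v‖_∞ + Σ_j ‖a_j·∇v‖_∞ ≤ 1 }`. -/
noncomputable def negReg (d r : ℕ) (X₀ : (Fin d → ℝ) → (Fin d → ℝ))
    (a : Fin r → (Fin d → ℝ) → (Fin d → ℝ)) (h : (Fin d → ℝ) → ℝ) : ℝ≥0∞ :=
  ⨆ v : {v : (Fin d → ℝ) → ℝ // ContDiff ℝ (⊤ : ℕ∞) v ∧ HasCompactSupport v ∧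
      (⨆ x, |v x|) + ∑ j : Fin r, (⨆ x, |fderiv ℝ v x (a j x)|) ≤ 1},
    ENNReal.ofReal |∫ x, h x * fderiv ℝ v.1 x (X₀ x)|

/-- The derivative of a smooth function along a continuous vector field is
continuous. -/
lemma continuous_fderiv_along {d : ℕ} {v : (Fin d → ℝ) → ℝ} (hv : ContDiff ℝ (⊤ : ℕ∞) v)
    {X : (Fin d → ℝ) → (Fin d → ℝ)} (hX : Continuous X) :
    Continuous fun x => fderiv ℝ v x (X x) :=
  (hv.continuous_fderiv (by simp)).clm_apply hX

lemma HasCompactSupport.fderiv_along {d : ℕ} {v : (Fin d → ℝ) → ℝ} (hv : HasCompactSupport v)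
    (X : (Fin d → ℝ) → (Fin d → ℝ)) : HasCompactSupport fun x => fderiv ℝ v x (X x) :=
  (hv.fderiv (𝕜 := ℝ)).mono fun x hx h => hx (by simp [h])

lemma exists_abs_le_of_hasCompactSupport {d : ℕ} {f : (Fin d → ℝ) → ℝ} (hf : Continuous f)
    (hfc : HasCompactSupport f) : ∃ K : ℝ, 0 ≤ K ∧ ∀ x, |f x| ≤ K := by
  obtain ⟨K, hK⟩ := hfc.exists_bound_of_continuous hf
  exact ⟨K, (norm_nonneg _).trans (hK 0), hK⟩

lemma abs_le_iSup_abs_of_hasCompactSupport {d : ℕ} {f : (Fin d → ℝ) → ℝ} (hf : Continuous f)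
    (hfc : HasCompactSupport f) (x : Fin d → ℝ) : |f x| ≤ ⨆ y, |f y| := by
  obtain ⟨K, -, hK⟩ := exists_abs_le_of_hasCompactSupport hf hfc
  exact le_ciSup (f := fun y => |f y|) ⟨K, by rintro _ ⟨y, rfl⟩; exact hK y⟩ x

lemma MeasureTheory.Integrable.mul_of_hasCompactSupport {d : ℕ} {h f : (Fin d → ℝ) → ℝ}
    (hh : Integrable h) (hf : Continuous f) (hfc : HasCompactSupport f) :
    Integrable fun x => h x * f x := by
  obtain ⟨K, -, hK⟩ := exists_abs_le_of_hasCompactSupport hf hfc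
  exact hh.mul_bdd hf.aestronglyMeasurable (.of_forall hK)

/-- Homogeneity: a test function of seminorm at most `C` pairs with `X₀ h` to at most
`C * negReg h`. -/
lemma ofReal_abs_integral_le_mul_negReg {d r : ℕ} {X₀ : (Fin d → ℝ) → (Fin d → ℝ)}
    {a : Fin r → (Fin d → ℝ) → (Fin d → ℝ)} (h : (Fin d → ℝ) → ℝ) {w : (Fin d → ℝ) → ℝ}
    (hw : ContDiff ℝ (⊤ : ℕ∞) w) (hwc : HasCompactSupport w) {C : ℝ} (hC : 0 < C)
    (hwC : (⨆ x, |w x|) + ∑ j : Fin r, (⨆ x, |fderiv ℝ w x (a j x)|) ≤ C) :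
    ENNReal.ofReal |∫ x, h x * fderiv ℝ w x (X₀ x)| ≤ ENNReal.ofReal C * negReg d r X₀ a h := by
  have hdiff : Differentiable ℝ w := hw.differentiable (by simp)
  have hderiv : ∀ x y, fderiv ℝ (fun x => C⁻¹ * w x) x y = C⁻¹ * fderiv ℝ w x y := fun x y => by
    rw [fderiv_const_mul (hdiff x)]; rfl
  have habs : ∀ t : ℝ, |C⁻¹ * t| = C⁻¹ * |t| := fun t => by
    rw [abs_mul, abs_of_pos (inv_pos.2 hC)]
  have hnorm : (⨆ x, |C⁻¹ * w x|) +
      ∑ j : Fin r, (⨆ x, |fderiv ℝ (fun x => C⁻¹ * w x) x (a j x)|) ≤ 1 := by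
    simp only [hderiv, habs, ← Real.mul_iSup_of_nonneg (inv_pos.2 hC).le, ← Finset.mul_sum,
      ← mul_add]
    rwa [inv_mul_le_iff₀ hC, mul_one]
  have key : ENNReal.ofReal |∫ x, h x * fderiv ℝ (fun x => C⁻¹ * w x) x (X₀ x)| ≤
      negReg d r X₀ a h :=
    le_iSup (fun v : {v : (Fin d → ℝ) → ℝ // ContDiff ℝ (⊤ : ℕ∞) v ∧ HasCompactSupport v ∧
      (⨆ x, |v x|) + ∑ j : Fin r, (⨆ x, |fderiv ℝ v x (a j x)|) ≤ 1} =>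
      ENNReal.ofReal |∫ x, h x * fderiv ℝ v.1 x (X₀ x)|)
      ⟨fun x => C⁻¹ * w x, contDiff_const.mul hw, hwc.mul_left, hnorm⟩
  refine le_trans (le_of_eq ?_) (mul_le_mul_right key _)
  simp only [hderiv, mul_left_comm _ C⁻¹, integral_const_mul, habs]
  rw [← ENNReal.ofReal_mul hC.le, mul_inv_cancel_left₀ hC.ne']

/-- Localization of the negative-regularity functional `𝔇`: for any open bounded `U` and
smooth cutoff `χ` compactly supported in `U`, `𝔇(χ·h) ≤ C (‖h‖_{L¹} + 𝔇(h))` for all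
integrable `h`. -/
theorem negReg_localization (d r : ℕ) (hd : 1 ≤ d) (hr : 1 ≤ r)
    (X₀ : (Fin d → ℝ) → (Fin d → ℝ)) (hX₀ : ContDiff ℝ 1 X₀)
    (a : Fin r → (Fin d → ℝ) → (Fin d → ℝ)) (ha : ∀ j, Continuous (a j))
    (U : Set (Fin d → ℝ)) (hU : IsOpen U) (hUb : Bornology.IsBounded U)
    (χ : (Fin d → ℝ) → ℝ) (hχ : ContDiff ℝ (⊤ : ℕ∞) χ) (hχc : HasCompactSupport χ)
    (hχU : tsupport χ ⊆ U) :
    ∃ C : ℝ, 0 < C ∧ ∀ h : (Fin d → ℝ) → ℝ, Integrable h →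
      negReg d r X₀ a (fun x => χ x * h x) ≤
        ENNReal.ofReal C * ((∫⁻ x, (‖h x‖₊ : ℝ≥0∞)) + negReg d r X₀ a h) := by
  have hχdiff : Differentiable ℝ χ := hχ.differentiable (by simp)
  obtain ⟨M, hM0, hM⟩ := exists_abs_le_of_hasCompactSupport hχ.continuous hχc
  obtain ⟨L, hL0, hL⟩ := exists_abs_le_of_hasCompactSupport
    (continuous_fderiv_along hχ hX₀.continuous) (hχc.fderiv_along X₀)
  choose K hK0 hK using fun j => exists_abs_le_of_hasCompactSupport
    (continuous_fderiv_along hχ (ha j)) (hχc.fderiv_along (a j))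
  have hKsum : 0 ≤ ∑ j, K j := Finset.sum_nonneg fun j _ => hK0 j
  have hC : 0 < M + L + ∑ j, K j + 1 := by positivity
  refine ⟨M + L + ∑ j, K j + 1, hC, fun h hh => iSup_le ?_⟩
  rintro ⟨v, hv, hvc, hv1⟩
  have hvdiff : Differentiable ℝ v := hv.differentiable (by simp)
  have hleibniz : ∀ x y, fderiv ℝ (fun x => χ x * v x) x y =
      χ x * fderiv ℝ v x y + v x * fderiv ℝ χ x y := fun x y => by
    rw [fderiv_fun_mul (hχdiff x) (hvdiff x)]; rfl
  have hw : ContDiff ℝ (⊤ : ℕ∞) fun x => χ x * v x := hχ.mul hv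
  have hwc : HasCompactSupport fun x => χ x * v x := hvc.mul_left
  have hvsup := abs_le_iSup_abs_of_hasCompactSupport hv.continuous hvc
  have hasup := fun j => abs_le_iSup_abs_of_hasCompactSupport
    (continuous_fderiv_along hv (ha j)) (hvc.fderiv_along (a j))
  have hA0 : 0 ≤ ⨆ x, |v x| := Real.iSup_nonneg fun x => abs_nonneg _
  have hB0 : 0 ≤ ∑ j, ⨆ x, |fderiv ℝ v x (a j x)| :=
    Finset.sum_nonneg fun j _ => Real.iSup_nonneg fun x => abs_nonneg _
  have hA1 : ⨆ x, |v x| ≤ 1 := by linarith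
  have hv_le : ∀ x, |v x| ≤ 1 := fun x => (hvsup x).trans hA1
  have hwsup : (⨆ x, |χ x * v x|) ≤ M * ⨆ x, |v x| := ciSup_le fun x => by
    rw [abs_mul]
    exact mul_le_mul (hM x) (hvsup x) (abs_nonneg _) hM0
  have hwasup : ∀ j, (⨆ x, |fderiv ℝ (fun x => χ x * v x) x (a j x)|) ≤
      M * (⨆ x, |fderiv ℝ v x (a j x)|) + K j := fun j => ciSup_le fun x => by
    rw [hleibniz]
    refine (abs_add_le _ _).trans (add_le_add ?_ ?_)
    · rw [abs_mul]
      exact mul_le_mul (hM x) (hasup j x) (abs_nonneg _) hM0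
    · rw [abs_mul, ← one_mul (K j)]
      exact mul_le_mul (hv_le x) (hK j x) (abs_nonneg _) zero_le_one
  have hwC : (⨆ x, |χ x * v x|) + ∑ j, (⨆ x, |fderiv ℝ (fun x => χ x * v x) x (a j x)|) ≤
      M + L + ∑ j, K j + 1 := by
    have hsum := Finset.sum_le_sum fun j (_ : j ∈ Finset.univ) => hwasup j
    rw [Finset.sum_add_distrib, ← Finset.mul_sum] at hsum
    have := mul_le_mul_of_nonneg_left hv1 hM0
    linarith
  have hint₁ : Integrable fun x => h x * fderiv ℝ (fun x => χ x * v x) x (X₀ x) :=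
    hh.mul_of_hasCompactSupport (continuous_fderiv_along hw hX₀.continuous) (hwc.fderiv_along X₀)
  have hint₂ : Integrable fun x => h x * (v x * fderiv ℝ χ x (X₀ x)) :=
    hh.mul_of_hasCompactSupport
      (hv.continuous.mul (continuous_fderiv_along hχ hX₀.continuous)) hvc.mul_right
  have hsplit : ∫ x, χ x * h x * fderiv ℝ v x (X₀ x) =
      (∫ x, h x * fderiv ℝ (fun x => χ x * v x) x (X₀ x)) -
        ∫ x, h x * (v x * fderiv ℝ χ x (X₀ x)) := by
    rw [← integral_sub hint₁ hint₂]
    refine integral_congr_ae (.of_forall fun x => ?_)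
    simp only [hleibniz]
    ring
  have hrem : |∫ x, h x * (v x * fderiv ℝ χ x (X₀ x))| ≤
      (M + L + ∑ j, K j + 1) * ∫ x, ‖h x‖ := by
    rw [← integral_const_mul, ← Real.norm_eq_abs]
    refine norm_integral_le_of_norm_le (hh.norm.const_mul _) (.of_forall fun x => ?_)
    rw [norm_mul, mul_comm]
    refine mul_le_mul_of_nonneg_right ?_ (norm_nonneg _)
    rw [Real.norm_eq_abs, abs_mul]
    have := mul_le_mul (hv_le x) (hL x) (abs_nonneg _) zero_le_one
    linarith
  calc ENNReal.ofReal |∫ x, χ x * h x * fderiv ℝ v x (X₀ x)|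
      ≤ ENNReal.ofReal (|∫ x, h x * (v x * fderiv ℝ χ x (X₀ x))| +
          |∫ x, h x * fderiv ℝ (fun x => χ x * v x) x (X₀ x)|) := by
        rw [hsplit, add_comm]
        exact ENNReal.ofReal_le_ofReal (abs_sub _ _)
    _ ≤ ENNReal.ofReal |∫ x, h x * (v x * fderiv ℝ χ x (X₀ x))| +
          ENNReal.ofReal |∫ x, h x * fderiv ℝ (fun x => χ x * v x) x (X₀ x)| :=
        ENNReal.ofReal_add_le
    _ ≤ _ := by
        rw [mul_add]
        refine add_le_add ?_ (ofReal_abs_integral_le_mul_negReg h hw hwc hC hwC)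
        refine (ENNReal.ofReal_le_ofReal hrem).trans (le_of_eq ?_)
        rw [ENNReal.ofReal_mul hC.le, ofReal_integral_norm_eq_lintegral_enorm hh]
        rfl
end
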